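/- arXiv:0903.0560 — 3 statements merged into one kernel-verified Lean document; each statement's English description precedes it below -/
import Mathlib

section
/- Let G be a finitely generated group such that every metabelian quotient of every finite-index subgroup of G is virtually nilpotent. Then every solvable quotient of every finite-index subgroup of G is virtually nilpotent. (Reduction step of Théorème 4.1, obtained from Théorème 4.3.) -/
/-- A group is virtually nilpotent if it has a nilpotent subgroup of finite index. -/
def VirtuallyNilpotent (G : Type*) [Group G] : Prop :=
  ∃ H : Subgroup G, H.FiniteIndex ∧ Group.IsNilpotent ↥H

section FreeAway

variable {D M : Type*} [CommRing D] [AddCommGroup M] [Module D M]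

theorem Finsupp.linearCombination_id_mem {s : Set M} {B : Submodule D M} (hs : s ⊆ B)
    {l : M →₀ D} (hl : l ∈ Finsupp.supported D D s) : Finsupp.linearCombination D id l ∈ B := by
  rw [Finsupp.linearCombination_apply]
  exact sum_mem fun x hx => B.smul_mem _ (hs (hl hx))

/-- The quotient `B / C` becomes free after inverting `f`: some `s ⊆ B` is linearly independent
modulo `C`, and spans `B` modulo `C` up to powers of `f`. -/
def FreeAway (f : D) (C B : Submodule D M) : Prop :=
  ∃ s : Set M, s ⊆ B ∧
    (∀ l ∈ Finsupp.supported D D s, Finsupp.linearCombination D id l ∈ C → l = 0) ∧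
    ∀ x ∈ B, ∃ n : ℕ, f ^ n • x ∈ Submodule.span D s ⊔ C

namespace FreeAway

variable {f g : D} {C E B : Submodule D M}

theorem mono_dvd (h : FreeAway f C B) (hfg : f ∣ g) : FreeAway g C B := by
  obtain ⟨s, hs, hli, hsp⟩ := h
  obtain ⟨c, rfl⟩ := hfg
  refine ⟨s, hs, hli, fun x hx => ?_⟩
  obtain ⟨n, hn⟩ := hsp x hx
  refine ⟨n, ?_⟩
  rw [mul_pow, mul_comm, mul_smul]
  exact Submodule.smul_mem _ _ hn

theorem map (h : FreeAway f C B) (e : M ≃ₗ[D] M) :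
    FreeAway f (C.map (e : M →ₗ[D] M)) (B.map (e : M →ₗ[D] M)) := by
  obtain ⟨s, hs, hli, hsp⟩ := h
  refine ⟨e '' s, Set.image_mono hs, fun l hl hlC => ?_, ?_⟩
  · have hl' : l.mapDomain e.symm ∈ Finsupp.supported D D s := by
      classical
      rw [Finsupp.mem_supported] at hl ⊢
      intro x hx
      have := Finsupp.mapDomain_support hx
      simp only [Finset.mem_image] at this
      obtain ⟨y, hy, rfl⟩ := this
      obtain ⟨z, hz, rfl⟩ := hl hy
      simpa using hz
    have h0 := hli _ hl' (by
      rw [Finsupp.linearCombination_mapDomain]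
      obtain ⟨c, hc, hce⟩ := hlC
      have : Finsupp.linearCombination D (id ∘ e.symm) l = c := by
        apply e.injective
        simp only [LinearEquiv.coe_coe] at hce
        rw [hce, Finsupp.linearCombination_apply, Finsupp.linearCombination_apply, Finsupp.sum,
          Finsupp.sum, map_sum]
        simp
      rwa [this])
    exact Finsupp.mapDomain_injective e.symm.injective (by simpa using h0)
  · rintro _ ⟨x, hx, rfl⟩
    obtain ⟨n, hn⟩ := hsp x hx
    refine ⟨n, ?_⟩
    rw [← map_smul]
    have := Submodule.mem_map_of_mem (f := (e : M →ₗ[D] M)) hn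
    rwa [Submodule.map_sup, Submodule.map_span] at this

theorem sup_of_inf (h : FreeAway f (C ⊓ B) B) : FreeAway f C (B ⊔ C) := by
  obtain ⟨s, hs, hli, hsp⟩ := h
  refine ⟨s, hs.trans (SetLike.coe_subset_coe.2 le_sup_left), fun l hl hlC => hli l hl
    ⟨hlC, Finsupp.linearCombination_id_mem hs hl⟩, fun x hx => ?_⟩
  obtain ⟨b, hb, c, hc, rfl⟩ := Submodule.mem_sup.1 hx
  obtain ⟨n, hn⟩ := hsp b hb
  refine ⟨n, ?_⟩
  rw [smul_add]
  exact add_mem (sup_le_sup_left (inf_le_left : C ⊓ B ≤ C) (Submodule.span D s) hn)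
    (Submodule.smul_mem _ _ (Submodule.mem_sup_right hc))

/-- A chain of successive quotients that are free away from `f`. -/
theorem iSup_nat (A : ℕ → Submodule D M) (hA : Monotone A)
    (h : ∀ n, FreeAway f (A n) (A (n + 1))) : FreeAway f (A 0) (⨆ n, A n) := by
  choose s hs hli hsp using h
  set S : ℕ → Set M := fun n => ⋃ i < n, s i with hS
  have hSsucc : ∀ n, S (n + 1) = S n ∪ s n := fun n => Set.biUnion_lt_succ s n
  have hSA : ∀ n, S n ⊆ A n := by
    intro n
    refine Set.iUnion₂_subset fun i hi => (hs i).trans ?_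
    exact SetLike.coe_subset_coe.2 (hA hi)
  have hSmono : Monotone S := fun m n hmn =>
    Set.biUnion_subset_biUnion_left fun i hi => lt_of_lt_of_le hi hmn
  have hSli : ∀ n, ∀ l ∈ Finsupp.supported D D (S n),
      Finsupp.linearCombination D id l ∈ A 0 → l = 0 := by
    intro n
    induction n with
    | zero =>
      intro l hl _
      simpa [hS, Finsupp.mem_supported] using hl
    | succ n ih =>
      intro l hl hlC
      rw [hSsucc, Finsupp.supported_union] at hl
      obtain ⟨l₁, h₁, l₂, h₂, rfl⟩ := Submodule.mem_sup.1 hl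
      have hm₁ : Finsupp.linearCombination D id l₁ ∈ A n :=
        Finsupp.linearCombination_id_mem (hSA n) h₁
      rw [map_add] at hlC
      have h₂0 : l₂ = 0 := hli n l₂ h₂ (by
        have := sub_mem (hA (Nat.zero_le n) hlC) hm₁
        simpa using this)
      subst h₂0
      rw [ih l₁ h₁ (by simpa using hlC), add_zero]
  have hSsp : ∀ n, ∀ x ∈ A n, ∃ k : ℕ, f ^ k • x ∈ Submodule.span D (⋃ n, S n) ⊔ A 0 := by
    intro n
    induction n with
    | zero => exact fun x hx => ⟨0, by simpa using Submodule.mem_sup_right hx⟩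
    | succ n ih =>
      intro x hx
      obtain ⟨k, hk⟩ := hsp n x hx
      obtain ⟨a, ha, u, hu, hau⟩ := Submodule.mem_sup.1 hk
      obtain ⟨k', hk'⟩ := ih u hu
      refine ⟨k' + k, ?_⟩
      rw [pow_add, mul_smul, ← hau, smul_add]
      refine add_mem (Submodule.mem_sup_left (Submodule.smul_mem _ _ ?_)) hk'
      refine Submodule.span_mono ?_ ha
      refine Set.Subset.trans ?_ (Set.subset_iUnion S (n + 1))
      rw [hSsucc]
      exact Set.subset_union_right
  refine ⟨⋃ n, S n, Set.iUnion_subset fun n => (hSA n).trans ?_, fun l hl hlC => ?_, fun x hx => ?_⟩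
  · exact SetLike.coe_subset_coe.2 (le_iSup A n)
  · obtain ⟨n, hn⟩ := (hSmono.directed_le).exists_mem_subset_of_finset_subset_biUnion
      (Finsupp.mem_supported _ _ |>.1 hl)
    exact hSli n l hn hlC
  · obtain ⟨n, hn⟩ := (Submodule.mem_iSup_of_directed A hA.directed_le).1 hx
    exact hSsp n x hn

theorem refl (f : D) (C : Submodule D M) : FreeAway f C C :=
  ⟨∅, by simp, by simp, fun x hx => ⟨0, by simpa using hx⟩⟩

theorem trans (h₁ : FreeAway f C E) (h₂ : FreeAway f E B) (hCE : C ≤ E) (hEB : E ≤ B) :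
    FreeAway f C B := by
  let A : ℕ → Submodule D M := fun n => if n = 0 then C else if n = 1 then E else B
  have hmono : Monotone A := monotone_nat_of_le_succ fun n => by
    rcases n with _ | _ | n <;> simp [A, hCE, hEB]
  have := iSup_nat (f := f) A hmono fun n => by
    rcases n with _ | _ | n
    · simpa [A] using h₁
    · simpa [A] using h₂
    · simpa [A] using refl f B
  have hsup : ⨆ n, A n = B := by
    refine le_antisymm (iSup_le fun n => ?_) (le_iSup_of_le 2 (by simp [A]))
    rcases n with _ | _ | n <;> simp [A, hEB, hCE.trans hEB]
  rw [hsup] at this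
  simpa [A] using this

theorem exists_of_finite [IsDomain D] {F : Set M} (hF : F.Finite) (C : Submodule D M) :
    ∃ f : D, f ≠ 0 ∧ FreeAway f C (Submodule.span D F ⊔ C) := by
  induction F, hF using Set.Finite.induction_on with
  | empty => exact ⟨1, one_ne_zero, by simpa using refl 1 C⟩
  | @insert a F _ _ ih =>
    obtain ⟨f, hf, hfree⟩ := ih
    set E := Submodule.span D F ⊔ C with hE
    have hins : Submodule.span D (insert a F) ⊔ C = Submodule.span D {a} ⊔ E := by
      rw [Submodule.span_insert, sup_assoc]
    have hlast : ∃ d : D, d ≠ 0 ∧ FreeAway d E (Submodule.span D {a} ⊔ E) := by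
      by_cases hd : ∃ d : D, d ≠ 0 ∧ d • a ∈ E
      · obtain ⟨d, hd, hda⟩ := hd
        refine ⟨d, hd, ∅, by simp, by simp, fun x hx => ⟨1, ?_⟩⟩
        obtain ⟨b, hb, e, he, rfl⟩ := Submodule.mem_sup.1 hx
        obtain ⟨c, rfl⟩ := Submodule.mem_span_singleton.1 hb
        simp only [Submodule.span_empty, bot_sup_eq, pow_one, smul_add]
        rw [smul_comm]
        exact add_mem (E.smul_mem _ hda) (E.smul_mem _ he)
      · push Not at hd
        refine ⟨1, one_ne_zero, {a}, ?_, fun l hl hlE => ?_, fun x hx => ⟨0, by simpa using hx⟩⟩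
        · simpa using Submodule.mem_sup_left (Submodule.mem_span_singleton_self a)
        · rw [Finsupp.mem_supported] at hl
          obtain ⟨c, rfl⟩ := Finsupp.support_subset_singleton'.1
            (show l.support ⊆ {a} by exact_mod_cast hl)
          by_contra hne
          refine hd c (fun h0 => hne (by simp [h0])) ?_
          simpa using hlE
    obtain ⟨d, hd, hlast⟩ := hlast
    refine ⟨f * d, mul_ne_zero hf hd, ?_⟩
    rw [hins]
    exact (hfree.mono_dvd (dvd_mul_right f d)).trans (hlast.mono_dvd (dvd_mul_left d f))
      le_sup_right le_sup_right

end FreeAway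

end FreeAway

theorem exists_stable_of_diagonal {α : Type*} [PartialOrder α] (f : ℕ → ℕ → α)
    (hf₁ : ∀ n, Monotone (f n)) (hf₂ : ∀ j, Monotone fun n => f n j)
    (hdiag : ∃ n₀, ∀ n ≥ n₀, f n n = f n₀ n₀) (hrow : ∀ n, ∃ j₀, ∀ j ≥ j₀, f n j = f n j₀) :
    ∃ J, ∀ j ≥ J, ∀ n, f n j = f n J := by
  obtain ⟨n₀, hn₀⟩ := hdiag
  choose r hr using hrow
  have key : ∀ n ≥ n₀, ∀ j ≥ n₀, f n j = f n₀ n₀ := fun n hn j hj =>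
    le_antisymm ((((hf₂ j) (le_max_left n j)).trans (hf₁ _ (le_max_right n j))).trans
      (hn₀ _ (le_max_of_le_left hn)).le) ((hf₁ _ hj).trans (hf₂ j hn))
  refine ⟨max n₀ ((Finset.range n₀).sup r), fun j hj n => ?_⟩
  rcases le_or_gt n₀ n with hn | hn
  · rw [key n hn j ((le_max_left _ _).trans hj), key n hn _ (le_max_left _ _)]
  · have hrn : r n ≤ max n₀ ((Finset.range n₀).sup r) :=
      le_max_of_le_right (Finset.le_sup (Finset.mem_range.2 hn))
    rw [hr n j (hrn.trans hj), hr n _ hrn]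

section Hall

variable {D M Q : Type*} [CommRing D] [AddCommGroup M] [Module D M] [Group Q]
  (ρ : Q →* Module.End D M)

/-- The submodule `C` is stable under the operators in `H`. -/
def IsStableUnder (H : Subgroup Q) (C : Submodule D M) : Prop :=
  ∀ h ∈ H, ∀ m ∈ C, ρ h m ∈ C

/-- The `H`-stable submodule generated by `F`. -/
def orbitSpan (H : Subgroup Q) (F : Set M) : Submodule D M :=
  Submodule.span D {m | ∃ h ∈ H, ∃ x ∈ F, ρ h x = m}

/-- The sum of the translates of `B` by `1, y, …, y ^ (n - 1)`. -/
def translateSum (y : Q) (B : Submodule D M) : ℕ → Submodule D M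
  | 0 => ⊥
  | n + 1 => translateSum y B n ⊔ B.map (ρ (y ^ n))

variable {ρ} {H : Subgroup Q} {B C : Submodule D M} {F : Set M} {y : Q}

theorem rho_mul_apply (g h : Q) (m : M) : ρ g (ρ h m) = ρ (g * h) m := by
  rw [map_mul, Module.End.mul_apply]

theorem mem_map_rho {g : Q} {m : M} : m ∈ C.map (ρ g) ↔ ρ g⁻¹ m ∈ C := by
  constructor
  · rintro ⟨c, hc, rfl⟩
    simpa [rho_mul_apply] using hc
  · exact fun h => ⟨_, h, by simp [rho_mul_apply]⟩

theorem map_rho_map_rho (g h : Q) : (C.map (ρ h)).map (ρ g) = C.map (ρ (g * h)) := by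
  rw [map_mul, Module.End.mul_eq_comp, Submodule.map_comp]

theorem FreeAway.map_rho {f : D} (h : FreeAway f C B) (g : Q) :
    FreeAway f (C.map (ρ g)) (B.map (ρ g)) :=
  h.map (LinearEquiv.ofLinearMap (ρ g) (ρ g⁻¹)
    (by rw [← Module.End.mul_eq_comp, ← map_mul, mul_inv_cancel, map_one]; rfl)
    (by rw [← Module.End.mul_eq_comp, ← map_mul, inv_mul_cancel, map_one]; rfl))

namespace IsStableUnder

theorem map_eq (hC : IsStableUnder ρ H C) {g : Q} (hg : g ∈ H) : C.map (ρ g) = C := by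
  ext m
  rw [mem_map_rho]
  refine ⟨fun h => ?_, fun h => hC _ (inv_mem hg) m h⟩
  simpa [rho_mul_apply] using hC g hg _ h

theorem anti {H' : Subgroup Q} (hC : IsStableUnder ρ H' C) (h : H ≤ H') : IsStableUnder ρ H C :=
  fun g hg => hC g (h hg)

theorem map_of_mem_normalizer (hC : IsStableUnder ρ H C) {g : Q}
    (hg : g ∈ Subgroup.normalizer (H : Set Q)) : IsStableUnder ρ H (C.map (ρ g)) := by
  intro h hh m hm
  rw [mem_map_rho] at hm ⊢
  have := hC (g⁻¹ * h * g) ((Subgroup.mem_normalizer_iff''.1 hg h).1 hh) _ hm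
  simpa only [rho_mul_apply, mul_assoc, mul_inv_cancel, mul_one] using this

theorem sup (hC : IsStableUnder ρ H C) (hB : IsStableUnder ρ H B) : IsStableUnder ρ H (C ⊔ B) := by
  intro h hh m hm
  obtain ⟨c, hc, b, hb, rfl⟩ := Submodule.mem_sup.1 hm
  rw [map_add]
  exact add_mem (Submodule.mem_sup_left (hC h hh c hc)) (Submodule.mem_sup_right (hB h hh b hb))

theorem inf (hC : IsStableUnder ρ H C) (hB : IsStableUnder ρ H B) : IsStableUnder ρ H (C ⊓ B) :=
  fun h hh m hm => ⟨hC h hh m hm.1, hB h hh m hm.2⟩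

theorem bot : IsStableUnder ρ H (⊥ : Submodule D M) := fun h _ m hm => by
  rw [Submodule.mem_bot] at hm ⊢
  rw [hm, map_zero]

theorem iSup_nat {A : ℕ → Submodule D M} (hA : Monotone A) (h : ∀ n, IsStableUnder ρ H (A n)) :
    IsStableUnder ρ H (⨆ n, A n) := by
  intro g hg m hm
  obtain ⟨n, hn⟩ := (Submodule.mem_iSup_of_directed A hA.directed_le).1 hm
  exact (le_iSup A n) (h n g hg m hn)

end IsStableUnder

theorem isStableUnder_orbitSpan : IsStableUnder ρ H (orbitSpan ρ H F) := by
  intro g hg m hm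
  have : orbitSpan ρ H F ≤ (orbitSpan ρ H F).comap (ρ g) := by
    refine Submodule.span_le.2 ?_
    rintro _ ⟨h, hh, x, hx, rfl⟩
    exact Submodule.subset_span ⟨g * h, mul_mem hg hh, x, hx, (rho_mul_apply g h x).symm⟩
  exact this hm

theorem orbitSpan_mono {H' : Subgroup Q} (h : H ≤ H') : orbitSpan ρ H F ≤ orbitSpan ρ H' F :=
  Submodule.span_mono fun _ ⟨g, hg, x, hx, e⟩ => ⟨g, h hg, x, hx, e⟩

section translateSum

theorem translateSum_succ (n : ℕ) :
    translateSum ρ y B (n + 1) = translateSum ρ y B n ⊔ B.map (ρ (y ^ n)) := rfl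

theorem translateSum_mono : Monotone (translateSum ρ y B) :=
  monotone_nat_of_le_succ fun _ => le_sup_left

theorem sup_map_translateSum (n : ℕ) :
    B ⊔ (translateSum ρ y B n).map (ρ y) = translateSum ρ y B (n + 1) := by
  induction n with
  | zero => simp [translateSum, Module.End.one_eq_id]
  | succ n ih =>
    rw [translateSum_succ, Submodule.map_sup, ← sup_assoc, ih, map_rho_map_rho, ← pow_succ',
      ← translateSum_succ]

theorem iSup_translateSum :
    B ⊔ (⨆ n, translateSum ρ y B n).map (ρ y) = ⨆ n, translateSum ρ y B n := by
  rw [Submodule.map_iSup, sup_iSup]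
  simp_rw [sup_map_translateSum]
  exact translateSum_mono.iSup_nat_add 1

theorem isStableUnder_translateSum (hB : IsStableUnder ρ H B)
    (hy : y ∈ Subgroup.normalizer (H : Set Q)) (n : ℕ) :
    IsStableUnder ρ H (translateSum ρ y B n) := by
  induction n with
  | zero => exact .bot
  | succ n ih => exact ih.sup (hB.map_of_mem_normalizer (pow_mem hy n))

theorem translateSum_le (hC : IsStableUnder ρ H C) (hy : y ∈ H) (hBC : B ≤ C) (n : ℕ) :
    translateSum ρ y B n ≤ C := by
  induction n with
  | zero => exact bot_le
  | succ n ih =>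
    refine sup_le ih ?_
    rw [← hC.map_eq (pow_mem hy n)]
    exact Submodule.map_mono hBC

theorem exists_zpow_mul_of_mem_sup_zpowers (hy : y ∈ Subgroup.normalizer (H : Set Q)) {g : Q}
    (hg : g ∈ H ⊔ Subgroup.zpowers y) : ∃ k : ℤ, ∃ h ∈ H, g = y ^ k * h := by
  have hn : Subgroup.zpowers y ≤ Subgroup.normalizer (H : Set Q) := by simpa using hy
  rw [sup_comm, ← SetLike.mem_coe, Subgroup.coe_mul_of_left_le_normalizer_right _ _ hn] at hg
  obtain ⟨_, ⟨k, rfl⟩, h, hh, rfl⟩ := hg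
  exact ⟨k, h, hh, rfl⟩

/-- The stable submodule under the group generated by `H` and `y` is exhausted by translates. -/
theorem orbitSpan_sup_zpowers (hy : y ∈ Subgroup.normalizer (H : Set Q))
    (hC : IsStableUnder ρ (H ⊔ Subgroup.zpowers y) C) :
    orbitSpan ρ (H ⊔ Subgroup.zpowers y) F ⊔ C =
      ⨆ n : ℕ, (C ⊔ ⨆ i, translateSum ρ y (orbitSpan ρ H F) i).map (ρ (y⁻¹ ^ n)) := by
  have hyH : y ∈ H ⊔ Subgroup.zpowers y :=
    Subgroup.mem_sup_right (Subgroup.mem_zpowers y)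
  apply le_antisymm
  · refine sup_le (Submodule.span_le.2 ?_) ?_
    · rintro _ ⟨g, hg, x, hx, rfl⟩
      obtain ⟨k, h, hh, rfl⟩ := exists_zpow_mul_of_mem_sup_zpowers hy hg
      have hB : ρ h x ∈ orbitSpan ρ H F := Submodule.subset_span ⟨h, hh, x, hx, rfl⟩
      rw [← rho_mul_apply]
      rcases k.eq_nat_or_neg with ⟨n, rfl | rfl⟩
      · refine Submodule.mem_iSup_of_mem 0 ?_
        rw [mem_map_rho]
        simp only [pow_zero, inv_one, map_one, Module.End.one_apply]
        refine Submodule.mem_sup_right (Submodule.mem_iSup_of_mem (n + 1) ?_)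
        exact Submodule.mem_sup_right ⟨_, hB, by simp⟩
      · refine Submodule.mem_iSup_of_mem n ?_
        refine ⟨ρ h x, Submodule.mem_sup_right (Submodule.mem_iSup_of_mem 1 ?_), by simp⟩
        exact Submodule.mem_sup_right ⟨_, hB, by simp⟩
    · refine le_iSup_of_le 0 ?_
      simp [Module.End.one_eq_id]
  · have hst := (isStableUnder_orbitSpan (ρ := ρ) (F := F) (H := H ⊔ Subgroup.zpowers y)).sup hC
    refine iSup_le fun n => ?_
    rw [← hst.map_eq (pow_mem (inv_mem hyH) n)]
    refine Submodule.map_mono (sup_le le_sup_right (iSup_le fun i => ?_))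
    exact translateSum_le hst hyH ((orbitSpan_mono le_sup_left).trans le_sup_left) i

end translateSum

variable (ρ) in
/-- The conclusions of Hall's theorems for the `H`-stable submodule generated by `F`: the ascending
chain condition on stable submodules, and generic freeness of its quotients. -/
structure HallCondition (F : Set M) (H : Subgroup Q) : Prop where
  acc : ∀ c : ℕ → Submodule D M, Monotone c → (∀ n, IsStableUnder ρ H (c n)) →
    ∃ n₀, ∀ n ≥ n₀, c n ⊓ orbitSpan ρ H F = c n₀ ⊓ orbitSpan ρ H F
  free : ∀ C : Submodule D M, IsStableUnder ρ H C →
    ∃ f : D, f ≠ 0 ∧ FreeAway f C (orbitSpan ρ H F ⊔ C)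

/-- The submodule of leading coefficients of degree `n`. -/
def leadingCoeff (ρ : Q →* Module.End D M) (y : Q) (B C : Submodule D M) (n : ℕ) :
    Submodule D M :=
  (C ⊔ translateSum ρ y B n).comap (ρ (y ^ n))

theorem leadingCoeff_mono_right (n : ℕ) : Monotone fun C => leadingCoeff ρ y B C n :=
  fun _ _ h => Submodule.comap_mono (sup_le_sup_right h _)

theorem leadingCoeff_mono (hC : IsStableUnder ρ H C) (hy : y ∈ H) :
    Monotone (leadingCoeff ρ y B C) := by
  refine monotone_nat_of_le_succ fun n m hm => ?_
  have h := Submodule.mem_map_of_mem (f := ρ y) (Submodule.mem_comap.1 hm)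
  rw [Submodule.map_sup, rho_mul_apply, ← pow_succ', hC.map_eq hy] at h
  refine sup_le_sup_left (?_ : (translateSum ρ y B n).map (ρ y) ≤ _) C h
  rw [← sup_map_translateSum]
  exact le_sup_right

theorem isStableUnder_leadingCoeff (hC : IsStableUnder ρ H C) (hB : IsStableUnder ρ H B)
    (hy : y ∈ Subgroup.normalizer (H : Set Q)) (n : ℕ) :
    IsStableUnder ρ H (leadingCoeff ρ y B C n) := by
  intro h hh m hm
  have := (hC.sup (isStableUnder_translateSum hB hy n)) (y ^ n * h * (y ^ n)⁻¹)
    ((Subgroup.mem_normalizer_iff.1 (pow_mem hy n) h).1 hh) _ (Submodule.mem_comap.1 hm)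
  rw [leadingCoeff, Submodule.mem_comap, rho_mul_apply]
  simpa only [rho_mul_apply, inv_mul_cancel_right] using this

theorem map_leadingCoeff (n : ℕ) :
    (leadingCoeff ρ y B C n).map (ρ (y ^ n)) = C ⊔ translateSum ρ y B n := by
  ext m
  rw [mem_map_rho, leadingCoeff, Submodule.mem_comap, rho_mul_apply]
  simp

/-- If two nested submodules have the same leading coefficients, they agree on polynomials. -/
theorem inf_translateSum_le {C' : Submodule D M} (hCC' : C ≤ C')
    (h : ∀ n, leadingCoeff ρ y B C' n ⊓ B ≤ leadingCoeff ρ y B C n) (n : ℕ) :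
    C' ⊓ translateSum ρ y B n ≤ C := by
  induction n with
  | zero => simp [translateSum]
  | succ n ih =>
    rintro m ⟨hm, hmt⟩
    obtain ⟨u, hu, _, ⟨b, hb, rfl⟩, rfl⟩ := Submodule.mem_sup.1 hmt
    have hbL : b ∈ leadingCoeff ρ y B C' n := by
      rw [leadingCoeff, Submodule.mem_comap]
      have := sub_mem (Submodule.mem_sup_left hm : _ ∈ C' ⊔ translateSum ρ y B n)
        (Submodule.mem_sup_right hu)
      simpa using this
    obtain ⟨w, hw, v, hv, hwv⟩ := Submodule.mem_sup.1 (Submodule.mem_comap.1 (h n ⟨hbL, hb⟩))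
    rw [← hwv] at hm ⊢
    have huv : u + v ∈ C := by
      refine ih ⟨?_, add_mem hu hv⟩
      have := sub_mem hm (hCC' hw)
      rwa [show u + (w + v) - w = u + v by abel] at this
    rw [show u + (w + v) = (u + v) + w by abel]
    exact add_mem huv hw

theorem HallCondition.acc_sup_zpowers (h : HallCondition ρ F H)
    (hy : y ∈ Subgroup.normalizer (H : Set Q)) (c : ℕ → Submodule D M) (hc : Monotone c)
    (hst : ∀ n, IsStableUnder ρ (H ⊔ Subgroup.zpowers y) (c n)) :
    ∃ n₀, ∀ n ≥ n₀, c n ⊓ orbitSpan ρ (H ⊔ Subgroup.zpowers y) F =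
      c n₀ ⊓ orbitSpan ρ (H ⊔ Subgroup.zpowers y) F := by
  set B := orbitSpan ρ H F with hB
  have hyH : y ∈ H ⊔ Subgroup.zpowers y := Subgroup.mem_sup_right (Subgroup.mem_zpowers y)
  have hBst : IsStableUnder ρ H B := isStableUnder_orbitSpan
  have hLst : ∀ n j, IsStableUnder ρ H (leadingCoeff ρ y B (c j) n) := fun n j =>
    isStableUnder_leadingCoeff ((hst j).anti le_sup_left) hBst hy n
  have hL₁ : ∀ n, Monotone fun j => leadingCoeff ρ y B (c j) n := fun n =>
    (leadingCoeff_mono_right n).comp hc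
  have hL₂ : ∀ j, Monotone fun n => leadingCoeff ρ y B (c j) n := fun j =>
    leadingCoeff_mono (hst j) hyH
  obtain ⟨J, hJ⟩ := exists_stable_of_diagonal (fun n j => leadingCoeff ρ y B (c j) n ⊓ B)
    (fun n _ _ hij => inf_le_inf_right _ (hL₁ n hij))
    (fun j _ _ hij => inf_le_inf_right _ (hL₂ j hij))
    (h.acc (fun n => leadingCoeff ρ y B (c n) n)
      (fun i j hij => (hL₁ i hij).trans (hL₂ j hij)) (fun n => hLst n n))
    (fun n => h.acc _ (hL₁ n) (hLst n))
  refine ⟨J, fun j hj => le_antisymm (le_inf (fun m hm => ?_) inf_le_right)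
    (inf_le_inf_right _ (hc hj))⟩
  have hm₂ : m ∈ orbitSpan ρ (H ⊔ Subgroup.zpowers y) F ⊔ (⊥ : Submodule D M) := by
    simpa using hm.2
  rw [orbitSpan_sup_zpowers hy .bot] at hm₂
  have hmono : Monotone fun n : ℕ =>
      ((⊥ : Submodule D M) ⊔ ⨆ i, translateSum ρ y B i).map (ρ (y⁻¹ ^ n)) := by
    refine monotone_nat_of_le_succ fun n => ?_
    rw [pow_succ, ← map_rho_map_rho]
    refine Submodule.map_mono fun m hm => ?_
    rw [mem_map_rho, inv_inv]
    rw [bot_sup_eq] at hm ⊢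
    rw [← iSup_translateSum]
    exact Submodule.mem_sup_right (Submodule.mem_map_of_mem hm)
  obtain ⟨n, hn⟩ := (Submodule.mem_iSup_of_directed _ hmono.directed_le).1 hm₂
  rw [mem_map_rho, bot_sup_eq] at hn
  obtain ⟨i, hi⟩ := (Submodule.mem_iSup_of_directed _ translateSum_mono.directed_le).1 hn
  have key := inf_translateSum_le (hc hj) (fun n => (hJ j hj n).le.trans inf_le_left) i
    ⟨hst j _ (inv_mem (pow_mem (inv_mem hyH) n)) m hm.1, hi⟩
  simpa only [rho_mul_apply, mul_inv_cancel, map_one, Module.End.one_apply] using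
    hst J _ (pow_mem (inv_mem hyH) n) _ key

theorem HallCondition.free_sup_zpowers [IsDomain D] (h : HallCondition ρ F H)
    (hy : y ∈ Subgroup.normalizer (H : Set Q))
    (hC : IsStableUnder ρ (H ⊔ Subgroup.zpowers y) C) :
    ∃ f : D, f ≠ 0 ∧ FreeAway f C (orbitSpan ρ (H ⊔ Subgroup.zpowers y) F ⊔ C) := by
  set B := orbitSpan ρ H F with hB
  have hyH : y ∈ H ⊔ Subgroup.zpowers y := Subgroup.mem_sup_right (Subgroup.mem_zpowers y)
  have hBst : IsStableUnder ρ H B := isStableUnder_orbitSpan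
  have hCH := hC.anti (le_sup_left : H ≤ H ⊔ Subgroup.zpowers y)
  have hLst : ∀ n, IsStableUnder ρ H (leadingCoeff ρ y B C n) :=
    isStableUnder_leadingCoeff hCH hBst hy
  obtain ⟨n₀, hn₀⟩ := h.acc _ (leadingCoeff_mono hC hyH) hLst
  have hfree : ∀ n, ∃ f : D, f ≠ 0 ∧ FreeAway f (leadingCoeff ρ y B C n ⊓ B) B := fun n => by
    obtain ⟨f, hf, hfr⟩ := h.free _ ((hLst n).inf hBst)
    exact ⟨f, hf, by rwa [sup_eq_left.2 inf_le_right] at hfr⟩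
  choose f hf hfr using hfree
  set P := ⨆ n, translateSum ρ y B n with hP
  have hCy : C.map (ρ y) = C := hC.map_eq hyH
  have hPst : IsStableUnder ρ H (C ⊔ P) :=
    hCH.sup (.iSup_nat translateSum_mono (isStableUnder_translateSum hBst hy))
  obtain ⟨g, hg, hgfr⟩ := h.free _ (hPst.map_of_mem_normalizer hy)
  have hBP : B ⊔ (C ⊔ P).map (ρ y) = C ⊔ P := by
    rw [Submodule.map_sup, hCy, sup_left_comm, iSup_translateSum]
  rw [hBP] at hgfr
  set e := (∏ n ∈ Finset.range (n₀ + 1), f n) * g with he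
  have hfe : ∀ n, FreeAway e (leadingCoeff ρ y B C n ⊓ B) B := fun n => by
    rcases le_or_gt n₀ n with hn | hn
    · rw [hn₀ n hn]
      exact (hfr n₀).mono_dvd ((Finset.dvd_prod_of_mem f (by simp)).mul_right g)
    · exact (hfr n).mono_dvd ((Finset.dvd_prod_of_mem f (by simp; omega)).mul_right g)
  have hpos : FreeAway e C (C ⊔ P) := by
    have := FreeAway.iSup_nat (f := e) (fun n => C ⊔ translateSum ρ y B n)
      (fun _ _ hij => sup_le_sup_left (translateSum_mono hij) C) fun n => by
        have := ((hfe n).sup_of_inf).map_rho (ρ := ρ) (y ^ n)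
        rw [Submodule.map_sup, map_leadingCoeff, sup_left_comm, sup_comm (B.map _)] at this
        exact this
    rw [← sup_iSup] at this
    simpa [translateSum] using this
  have hstep : ∀ n : ℕ, (C ⊔ P).map (ρ (y⁻¹ ^ n)) =
      ((C ⊔ P).map (ρ y)).map (ρ (y⁻¹ ^ (n + 1))) := fun n => by
    rw [map_rho_map_rho, pow_succ, mul_assoc, inv_mul_cancel, mul_one]
  have hmono : Monotone fun n : ℕ => (C ⊔ P).map (ρ (y⁻¹ ^ n)) :=
    monotone_nat_of_le_succ fun n => by
      rw [hstep]
      refine Submodule.map_mono ?_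
      conv_rhs => rw [← hBP]
      exact le_sup_right
  refine ⟨e, mul_ne_zero (Finset.prod_ne_zero_iff.2 fun n _ => hf n) hg, ?_⟩
  rw [orbitSpan_sup_zpowers hy hC]
  have hneg := FreeAway.iSup_nat (f := e) _ hmono fun n => by
    simp only [hstep n]
    exact (hgfr.mono_dvd (Dvd.intro_left _ rfl)).map_rho _
  have h0 : (C ⊔ P).map (ρ (y⁻¹ ^ 0)) = C ⊔ P := by simp [Module.End.one_eq_id]
  simp only [h0] at hneg
  exact hpos.trans hneg le_sup_left (h0.symm.le.trans
    (le_iSup (fun n : ℕ => (C ⊔ P).map (ρ (y⁻¹ ^ n))) 0))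

theorem HallCondition.sup_zpowers [IsDomain D] (h : HallCondition ρ F H)
    (hy : y ∈ Subgroup.normalizer (H : Set Q)) : HallCondition ρ F (H ⊔ Subgroup.zpowers y) :=
  ⟨h.acc_sup_zpowers hy, fun _ => h.free_sup_zpowers hy⟩

theorem hallCondition_of_trivial [IsDomain D] [IsNoetherianRing D] (hF : F.Finite)
    (hH : ∀ h ∈ H, ρ h = 1) : HallCondition ρ F H := by
  have hspan : orbitSpan ρ H F = Submodule.span D F := by
    refine le_antisymm (Submodule.span_mono ?_) (Submodule.span_mono fun x hx => ?_)
    · rintro _ ⟨h, hh, x, hx, rfl⟩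
      simpa [hH h hh] using hx
    · exact ⟨1, one_mem H, x, hx, by simp⟩
  refine ⟨fun c hc _ => ?_, fun C _ => ?_⟩
  · rw [hspan]
    have : IsNoetherian D (Submodule.span D F) := isNoetherian_span_of_finite D hF
    obtain ⟨n, hn⟩ := monotone_stabilizes_iff_noetherian.2 this
      ⟨fun n => (c n).submoduleOf (Submodule.span D F), fun i j hij =>
        Submodule.comap_mono (hc hij)⟩
    refine ⟨n, fun m hm => ?_⟩
    have := congrArg (Submodule.map (Submodule.span D F).subtype) (hn m hm)
    simpa [Submodule.submoduleOf, inf_comm] using this.symm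
  · rw [hspan]
    exact FreeAway.exists_of_finite hF C

end Hall

section FinitelyGeneratedNilpotent

open Subgroup
open scoped commutatorElement

variable {Q : Type*} [Group Q]

theorem top_le_center_of_closure {S : Set Q} (hS : closure S = ⊤) {x : Q}
    (h : ∀ s ∈ S, s * x = x * s) : x ∈ center Q := by
  have : closure S ≤ centralizer {x} := (Subgroup.closure_le _).2 fun s hs =>
    mem_centralizer_singleton_iff.2 (h s hs)
  rw [hS] at this
  exact mem_center_iff.2 fun g => mem_centralizer_singleton_iff.1 (this (mem_top g))

theorem exists_finite_lowerCentralSeries_eq_normalClosure [Group.FG Q] (n : ℕ) :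
    ∃ C : Set Q, C.Finite ∧ (⊤ : Subgroup Q).lowerCentralSeries n = normalClosure C := by
  obtain ⟨S, hS, hSfin⟩ := Group.fg_iff.1 ‹Group.FG Q›
  induction n with
  | zero =>
    refine ⟨S, hSfin, ?_⟩
    rw [Subgroup.lowerCentralSeries_zero, eq_comm, eq_top_iff, ← hS]
    exact closure_le_normalClosure
  | succ n ih =>
    obtain ⟨C, hC, hCn⟩ := ih
    refine ⟨Set.image2 (fun x s => ⁅x, s⁆) C S, hC.image2 _ hSfin, ?_⟩
    set N := normalClosure (Set.image2 (fun x s : Q => ⁅x, s⁆) C S) with hN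
    apply le_antisymm
    · have hle : normalClosure C ≤ (center (Q ⧸ N)).comap (QuotientGroup.mk' N) := by
        refine normalClosure_le_normal fun x hx => ?_
        refine top_le_center_of_closure (S := QuotientGroup.mk' N '' S) ?_ ?_
        · rw [← MonoidHom.map_closure, hS, ← MonoidHom.range_eq_map, MonoidHom.range_eq_top]
          exact QuotientGroup.mk'_surjective N
        · rintro _ ⟨s, hs, rfl⟩
          rw [eq_comm, ← commutatorElement_eq_one_iff_mul_comm, ← map_commutatorElement]
          exact (QuotientGroup.eq_one_iff _).2 (subset_normalClosure ⟨x, hx, s, hs, rfl⟩)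
      rw [Subgroup.lowerCentralSeries_succ, hCn, commutator_le]
      intro x hx g _
      have := mem_center_iff.1 (hle hx) (QuotientGroup.mk' N g)
      rw [eq_comm, ← commutatorElement_eq_one_iff_mul_comm, ← map_commutatorElement] at this
      exact (QuotientGroup.eq_one_iff _).1 this
    · refine normalClosure_le_normal ?_
      rintro _ ⟨x, hx, s, _, rfl⟩
      refine commutator_mem_commutator ?_ (mem_top s)
      rw [hCn]
      exact subset_normalClosure hx

theorem mem_normalizer_of_commutator_le {H : Subgroup Q} {x : Q}
    (hN : ∀ h ∈ H, ⁅x, h⁆ ∈ H) (hN' : ∀ h ∈ H, ⁅x⁻¹, h⁆ ∈ H) :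
    x ∈ normalizer (H : Set Q) := by
  rw [mem_normalizer_iff]
  intro h
  constructor
  · intro hh
    simpa [commutatorElement_def] using mul_mem (hN h hh) hh
  · intro hh
    have := mul_mem (hN' _ hh) hh
    simpa [commutatorElement_def, mul_assoc] using this

theorem lowerCentralSeries_eq_sup_closure {C : Set Q} {n : ℕ}
    (hC : (⊤ : Subgroup Q).lowerCentralSeries n = normalClosure C) :
    (⊤ : Subgroup Q).lowerCentralSeries n =
      (⊤ : Subgroup Q).lowerCentralSeries (n + 1) ⊔ closure C := by
  have hCle : closure C ≤ (⊤ : Subgroup Q).lowerCentralSeries n := by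
    rw [hC]
    exact closure_le_normalClosure
  have hle : (⊤ : Subgroup Q).lowerCentralSeries (n + 1) ⊔ closure C ≤
      (⊤ : Subgroup Q).lowerCentralSeries n :=
    sup_le (Subgroup.lowerCentralSeries_antitone _ n.le_succ) hCle
  refine le_antisymm ?_ hle
  have : ((⊤ : Subgroup Q).lowerCentralSeries (n + 1) ⊔ closure C).Normal := by
    refine ⟨fun h hh g => ?_⟩
    have h1 : ⁅h, g⁆ ∈ (⊤ : Subgroup Q).lowerCentralSeries (n + 1) :=
      commutator_mem_commutator (hle hh) (mem_top g)
    have : ⁅h, g⁆⁻¹ * h ∈ (⊤ : Subgroup Q).lowerCentralSeries (n + 1) ⊔ closure C :=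
      mul_mem (mem_sup_left (inv_mem h1)) hh
    simpa [commutatorElement_def, mul_assoc] using this
  conv_lhs => rw [hC]
  exact normalClosure_le_normal (subset_closure.trans
    (SetLike.coe_subset_coe.2 (le_sup_right)))

/-- Finitely generated nilpotent groups are polycyclic, as an induction principle. -/
theorem polycyclic_induction [Group.FG Q] {A : Subgroup Q} {c : ℕ}
    (hA : (⊤ : Subgroup Q).lowerCentralSeries c ≤ A) {p : Subgroup Q → Prop} (base : p A)
    (step : ∀ H y, A ≤ H → y ∈ normalizer (H : Set Q) → p H → p (H ⊔ zpowers y)) : p ⊤ := by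
  have key : ∀ k n, n + k = c → p (A ⊔ (⊤ : Subgroup Q).lowerCentralSeries n) := by
    intro k
    induction k with
    | zero =>
      rintro n rfl
      rw [add_zero] at hA
      rwa [sup_eq_left.2 hA]
    | succ k ih =>
      intro n hn
      have hp := ih (n + 1) (by omega)
      obtain ⟨C, hCfin, hC⟩ := exists_finite_lowerCentralSeries_eq_normalClosure (Q := Q) n
      have hall : ∀ T ⊆ C, T.Finite →
          p (A ⊔ (⊤ : Subgroup Q).lowerCentralSeries (n + 1) ⊔ closure T) := by
        intro T hTC hT
        induction T, hT using Set.Finite.induction_on with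
        | empty => simpa using hp
        | @insert x T _ _ ihT =>
          rw [Set.insert_eq, Subgroup.closure_union, ← zpowers_eq_closure, sup_comm (zpowers x),
            ← sup_assoc]
          refine step _ _ (le_sup_left.trans le_sup_left) ?_
            (ihT ((Set.subset_insert x T).trans hTC))
          have hx : x ∈ (⊤ : Subgroup Q).lowerCentralSeries n := by
            rw [hC]
            exact subset_normalClosure (hTC (Set.mem_insert x T))
          exact mem_normalizer_of_commutator_le
            (fun h _ => mem_sup_left (mem_sup_right (commutator_mem_commutator hx (mem_top h))))
            (fun h _ => mem_sup_left (mem_sup_right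
              (commutator_mem_commutator (inv_mem hx) (mem_top h))))
      have := hall C subset_rfl hCfin
      rwa [sup_assoc, ← lowerCentralSeries_eq_sup_closure hC] at this
  simpa using key c 0 (zero_add c)

/-- The subgroups of an extension of a group by a cyclic group are generated by their intersection
with the kernel and one more element. -/
theorem exists_eq_inf_sup_zpowers {H K : Subgroup Q} {y : Q} (hy : y ∈ normalizer (H : Set Q))
    (hK : K ≤ H ⊔ zpowers y) : ∃ k, K = (K ⊓ H) ⊔ zpowers k := by
  let S : Subgroup (Multiplicative ℤ × Q) :=
    { carrier := {z | ∃ h ∈ H, z.2 = y ^ z.1.toAdd * h}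
      one_mem' := ⟨1, one_mem H, by simp⟩
      mul_mem' := by
        rintro ⟨m, g⟩ ⟨n, g'⟩ ⟨h, hh, e⟩ ⟨h', hh', e'⟩
        obtain rfl : g = y ^ m.toAdd * h := e
        obtain rfl : g' = y ^ n.toAdd * h' := e'
        refine ⟨(y ^ n.toAdd)⁻¹ * h * y ^ n.toAdd * h', mul_mem ?_ hh', ?_⟩
        · exact (mem_normalizer_iff''.1 (zpow_mem hy _) h).1 hh
        · simp [zpow_add, mul_assoc]
      inv_mem' := by
        rintro ⟨m, g⟩ ⟨h, hh, e⟩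
        obtain rfl : g = y ^ m.toAdd * h := e
        refine ⟨y ^ m.toAdd * h⁻¹ * (y ^ m.toAdd)⁻¹, ?_, ?_⟩
        · exact (mem_normalizer_iff.1 (zpow_mem hy _) _).1 (inv_mem hh)
        · simp [zpow_neg, mul_assoc] }
  let Z : AddSubgroup ℤ :=
    Subgroup.toAddSubgroup' ((S ⊓ K.comap (MonoidHom.snd _ _)).map (MonoidHom.fst _ _))
  have hZ : ∀ n : ℤ, n ∈ Z ↔ ∃ k ∈ K, (Multiplicative.ofAdd n, k) ∈ S := by
    intro n
    constructor
    · rintro ⟨⟨m, k⟩, ⟨hS, hk⟩, rfl⟩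
      exact ⟨k, hk, hS⟩
    · rintro ⟨k, hk, hS⟩
      exact ⟨(Multiplicative.ofAdd n, k), ⟨hS, hk⟩, rfl⟩
  obtain ⟨a, ha⟩ := Int.subgroup_cyclic Z
  obtain ⟨k₀, hk₀, hk₀S⟩ := (hZ a).1 (ha ▸ AddSubgroup.subset_closure rfl)
  refine ⟨k₀, le_antisymm (fun k hk => ?_) (sup_le inf_le_left (by simpa using hk₀))⟩
  have hn : zpowers y ≤ normalizer (H : Set Q) := by simpa using hy
  have hk' := hK hk
  rw [sup_comm, ← SetLike.mem_coe, coe_mul_of_left_le_normalizer_right _ _ hn] at hk'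
  obtain ⟨_, ⟨n, rfl⟩, h, hh, rfl⟩ := hk'
  have hnS : (Multiplicative.ofAdd n, y ^ n * h) ∈ S := ⟨h, hh, rfl⟩
  have hnZ : n ∈ Z := (hZ n).2 ⟨_, hk, hnS⟩
  rw [ha, AddSubgroup.mem_closure_singleton] at hnZ
  obtain ⟨m, rfl⟩ := hnZ
  obtain ⟨h', hh', e⟩ := mul_mem (inv_mem (zpow_mem hk₀S m)) hnS
  have e₀ : ((Multiplicative.ofAdd a ^ m)⁻¹ * Multiplicative.ofAdd (m • a)).toAdd = 0 := by
    rw [ofAdd_zsmul, inv_mul_cancel, toAdd_one]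
  have e' : (k₀ ^ m)⁻¹ * (y ^ (m • a) * h) = h' := by
    refine Eq.trans e ?_
    refine Eq.trans (congrArg (fun i => y ^ i * h') e₀) ?_
    simp
  have : y ^ (m • a) * h = k₀ ^ m * h' := by rw [← e', mul_inv_cancel_left]
  change y ^ (m • a) * h ∈ K at hk
  change y ^ (m • a) * h ∈ _
  rw [this] at hk ⊢
  have hm : k₀ ^ m ∈ zpowers k₀ := zpow_mem (mem_zpowers k₀) m
  refine mul_mem (mem_sup_right hm) (mem_sup_left ⟨?_, hh'⟩)
  have := mul_mem (inv_mem (zpow_mem hk₀ m)) hk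
  rwa [inv_mul_cancel_left] at this

theorem exists_finite_eq_sup_closure [Group.FG Q] {A : Subgroup Q} {c : ℕ}
    (hA : (⊤ : Subgroup Q).lowerCentralSeries c ≤ A) {K : Subgroup Q} (hAK : A ≤ K) :
    ∃ T : Set Q, T.Finite ∧ K = A ⊔ closure T := by
  suffices h : ∀ K : Subgroup Q, A ≤ K → K ≤ ⊤ → ∃ T : Set Q, T.Finite ∧ K = A ⊔ closure T from
    h K hAK le_top
  refine polycyclic_induction hA (p := fun H => ∀ K : Subgroup Q, A ≤ K → K ≤ H →
    ∃ T : Set Q, T.Finite ∧ K = A ⊔ closure T) ?_ ?_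
  · exact fun K h₁ h₂ => ⟨∅, Set.finite_empty, by simpa using le_antisymm h₂ h₁⟩
  · intro H y hAH hy ih K hAK hK
    obtain ⟨k, hk⟩ := exists_eq_inf_sup_zpowers hy hK
    obtain ⟨T, hT, hTK⟩ := ih (K ⊓ H) (le_inf hAK hAH) inf_le_right
    refine ⟨T ∪ {k}, hT.union (Set.finite_singleton k), ?_⟩
    rw [Subgroup.closure_union, ← zpowers_eq_closure, ← sup_assoc, ← hTK, ← hk]

theorem wellFoundedGT_subgroups_above [Group.FG Q] {A : Subgroup Q} {c : ℕ}
    (hA : (⊤ : Subgroup Q).lowerCentralSeries c ≤ A) :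
    WellFoundedGT {K : Subgroup Q // A ≤ K} := by
  rw [wellFoundedGT_iff_monotone_chain_condition]
  intro K
  have hdir : Directed (· ≤ ·) fun n => (K n : Subgroup Q) :=
    Monotone.directed_le fun i j hij => K.monotone hij
  have hle : A ≤ ⨆ n, (K n : Subgroup Q) := (K 0).2.trans (le_iSup (fun n => (K n : Subgroup Q)) 0)
  obtain ⟨T, hT, hTK⟩ := exists_finite_eq_sup_closure hA hle
  have hTsub : T ⊆ ⋃ n, ((K n : Subgroup Q) : Set Q) := by
    rw [← coe_iSup_of_directed hdir, hTK]
    exact subset_closure.trans (SetLike.coe_subset_coe.2 le_sup_right)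
  obtain ⟨n, hn⟩ := (show Directed (· ⊆ ·) fun n => ((K n : Subgroup Q) : Set Q) from
    hdir).exists_mem_subset_of_finset_subset_biUnion (s := hT.toFinset) (by simpa using hTsub)
  refine ⟨n, fun m hm => le_antisymm (K.monotone hm) (?_ : (K m : Subgroup Q) ≤ K n)⟩
  refine (le_iSup (fun n => (K n : Subgroup Q)) m).trans ?_
  rw [hTK]
  exact sup_le (K n).2 ((Subgroup.closure_le _).2 (by simpa using hn))

theorem exists_finite_eq_normalClosure [Group.FG Q] {A : Subgroup Q} [A.Normal] {c : ℕ}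
    (hA : (⊤ : Subgroup Q).lowerCentralSeries c ≤ A) :
    ∃ T : Set Q, T.Finite ∧ A = normalClosure T := by
  obtain ⟨C, hC, hCe⟩ := exists_finite_lowerCentralSeries_eq_normalClosure (Q := Q) c
  obtain ⟨T, hT, hTe⟩ := exists_finite_eq_sup_closure le_rfl hA
  refine ⟨C ∪ T, hC.union hT, le_antisymm ?_ (normalClosure_le_normal (Set.union_subset ?_ ?_))⟩
  · rw [hTe, hCe]
    exact sup_le (normalClosure_mono Set.subset_union_left)
      ((Subgroup.closure_mono Set.subset_union_right).trans closure_le_normalClosure)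
  · exact subset_normalClosure.trans (SetLike.coe_subset_coe.2 (hCe ▸ hA))
  · rw [hTe]
    exact subset_closure.trans (SetLike.coe_subset_coe.2 le_sup_right)

theorem exists_finite_eq_sup_closure_of_finiteIndex [Group.FG Q] {J A L : Subgroup Q}
    [L.FiniteIndex] {n : ℕ} (hL : L.lowerCentralSeries n ≤ J) (hJA : J ≤ A) :
    ∃ T : Set Q, T.Finite ∧ A = J ⊔ closure T := by
  have : Group.FG L := fg_of_index_ne_zero L
  have hle : (⊤ : Subgroup L).lowerCentralSeries n ≤ A.subgroupOf L := by
    rw [subgroupOf, ← map_le_iff_le_comap, Subgroup.top_subtype_lowerCentralSeries]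
    exact hL.trans hJA
  obtain ⟨T, hT, hTe⟩ := exists_finite_eq_sup_closure le_rfl hle
  have hAL : A ⊓ L = L.lowerCentralSeries n ⊔ closure (L.subtype '' T) := by
    rw [← subgroupOf_map_subtype, hTe, Subgroup.map_sup, top_subtype_lowerCentralSeries,
      MonoidHom.map_closure]
  let r : A ⧸ L.subgroupOf A → Q := fun q => (q.out : A)
  refine ⟨L.subtype '' T ∪ Set.range r, (hT.image _).union (Set.finite_range r),
    le_antisymm (fun a ha => ?_) (sup_le hJA ((Subgroup.closure_le _).2 (Set.union_subset ?_ ?_)))⟩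
  · obtain ⟨l, hl⟩ := QuotientGroup.mk_out_eq_mul (L.subgroupOf A) ⟨a, ha⟩
    have hlA : ((l : A) : Q) ∈ A ⊓ L := ⟨(l : A).2, l.2⟩
    rw [hAL] at hlA
    have hlA' : ((l : A) : Q) ∈ J ⊔ closure (L.subtype '' T ∪ Set.range r) :=
      sup_le_sup hL (Subgroup.closure_mono Set.subset_union_left) hlA
    have hr : r (QuotientGroup.mk ⟨a, ha⟩) ∈ J ⊔ closure (L.subtype '' T ∪ Set.range r) :=
      mem_sup_right (Subgroup.subset_closure (Or.inr ⟨_, rfl⟩))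
    have e : r (QuotientGroup.mk ⟨a, ha⟩) = a * (l : A) := congrArg Subtype.val hl
    have := mul_mem hr (inv_mem hlA')
    rwa [e, mul_inv_cancel_right] at this
  · have : closure (L.subtype '' T) ≤ A ⊓ L := hAL ▸ le_sup_right
    exact subset_closure.trans (SetLike.coe_subset_coe.2 (this.trans inf_le_left))
  · rintro _ ⟨q, rfl⟩
    exact (q.out).2

end FinitelyGeneratedNilpotent

section FiniteType

instance Int.isJacobsonRing : IsJacobsonRing ℤ := by
  rw [isJacobsonRing_iff_prime_eq]
  intro P hP
  by_cases h0 : P = ⊥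
  · subst h0
    refine le_antisymm (fun x hx => ?_) Ideal.le_jacobson
    have := Ideal.mem_jacobson_bot.1 hx (2 * x)
    rcases Int.isUnit_iff.1 this with h | h
    · rw [Ideal.mem_bot]
      nlinarith
    · nlinarith [sq_nonneg x]
  · have := IsPrime.to_maximal_ideal h0
    exact le_antisymm (this.eq_of_le (Ideal.jacobson_eq_top_iff.not.2 this.ne_top)
      Ideal.le_jacobson).ge Ideal.le_jacobson

theorem finite_of_isField_of_finiteType_int {K : Type*} [CommRing K] (hK : IsField K)
    [Algebra.FiniteType ℤ K] : Finite K := by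
  let _ := hK.toField
  have := finite_of_finite_type_of_isJacobsonRing ℤ K
  obtain ⟨p, hp⟩ := CharP.exists K
  rcases Nat.eq_zero_or_pos p with rfl | hpos
  · have := CharP.charP_to_charZero K
    exact absurd (isField_of_isIntegral_of_isField (R := ℤ) (S := K) (Int.cast_injective)
      (Field.toIsField K)) Int.not_isField
  · refine Module.finite_of_fg_torsion K fun x => ⟨⟨(p : ℤ), ?_⟩, ?_⟩
    · simpa using hpos.ne'
    · simp [Submonoid.smul_def]

theorem exists_isMaximal_notMem_of_finiteType_int {D : Type*} [CommRing D] [IsDomain D]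
    [Algebra.FiniteType ℤ D] {f : D} (hf : f ≠ 0) :
    ∃ m : Ideal D, m.IsMaximal ∧ Finite (D ⧸ m) ∧ f ∉ m := by
  have : IsJacobsonRing D := isJacobsonRing_of_finiteType (A := ℤ)
  have hj : (⊥ : Ideal D).jacobson = ⊥ := IsJacobsonRing.out this Ideal.isPrime_bot.isRadical
  by_contra! h
  have hmem : f ∈ (⊥ : Ideal D).jacobson := by
    rw [Ideal.jacobson, Ideal.mem_sInf]
    rintro m ⟨-, hm⟩
    have : @Algebra.FiniteType ℤ (D ⧸ m) _ _ (Ring.toIntAlgebra _) :=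
      Algebra.FiniteType.of_surjective (Ideal.Quotient.mk m).toIntAlgHom
        Ideal.Quotient.mk_surjective
    exact h m hm (finite_of_isField_of_finiteType_int
      ((Ideal.Quotient.maximal_ideal_iff_isField_quotient m).1 hm))
  rw [hj] at hmem
  exact hf hmem

end FiniteType

section FreeAwayFinite

variable {D M : Type*} [CommRing D] [AddCommGroup M] [Module D M]

theorem finite_of_linearIndepOn_of_finite_quotient {m : Ideal D} [m.IsPrime] {f : D} (hf : f ∉ m)
    [Finite (M ⧸ m • (⊤ : Submodule D M))] {s : Set M} (hs : LinearIndepOn D id s)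
    (hspan : ∀ x, ∃ n : ℕ, f ^ n • x ∈ Submodule.span D s) : s.Finite := by
  have key : ∀ z ∈ m • (⊤ : Submodule D M), ∃ n : ℕ, f ^ n • z ∈ m • Submodule.span D s := by
    intro z hz
    refine Submodule.smul_induction_on hz (fun r hr x _ => ?_) fun x y hx hy => ?_
    · obtain ⟨n, hn⟩ := hspan x
      exact ⟨n, smul_comm (f ^ n) r x ▸ Submodule.smul_mem_smul hr hn⟩
    · obtain ⟨n, hn⟩ := hx
      obtain ⟨k, hk⟩ := hy
      refine ⟨n + k, ?_⟩
      rw [smul_add]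
      refine add_mem ?_ ?_
      · rw [pow_add, mul_comm, mul_smul]
        exact Submodule.smul_mem _ _ hn
      · rw [pow_add, mul_smul]
        exact Submodule.smul_mem _ _ hk
  rw [← Set.finite_coe_iff]
  refine Finite.of_injective (fun a : s => (m • (⊤ : Submodule D M)).mkQ a) fun a b hab => ?_
  by_contra hne
  obtain ⟨n, hn⟩ := key _ ((Submodule.Quotient.eq _).1 hab)
  have hn' := (Submodule.mem_ideal_smul_span_iff_exists_sum m (Subtype.val : s → M) _).1
    (by rwa [Subtype.range_coe])
  obtain ⟨l, hl, e⟩ := hn'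
  have hli : LinearIndependent D (Subtype.val : s → M) := hs
  have hl' : l = Finsupp.single a (f ^ n) - Finsupp.single b (f ^ n) := by
    apply hli
    rw [map_sub, Finsupp.linearCombination_single, Finsupp.linearCombination_single, ← smul_sub,
      ← e]
    rfl
  have := hl a
  rw [hl', Finsupp.sub_apply, Finsupp.single_eq_same, Finsupp.single_eq_of_ne (by tauto),
    sub_zero] at this
  exact hf (Ideal.IsPrime.mem_of_pow_mem ‹_› n this)

open TensorProduct

variable [IsDomain D]

theorem finite_fractionRing_tensorProduct {f : D} (hf : f ≠ 0) {s : Set M} (hfin : s.Finite)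
    (hspan : ∀ x, ∃ n : ℕ, f ^ n • x ∈ Submodule.span D s) :
    Module.Finite (FractionRing D) (FractionRing D ⊗[D] M) := by
  let K := FractionRing D
  let i : M →ₗ[D] K ⊗[D] M := TensorProduct.mk D K M 1
  have hi : ∀ x, i x ∈ Submodule.span K (i '' s) := by
    intro x
    obtain ⟨n, hn⟩ := hspan x
    have h1 : i (f ^ n • x) ∈ Submodule.span K (i '' s) := by
      have : i (f ^ n • x) ∈ (Submodule.span D s).map i := Submodule.mem_map_of_mem hn
      rw [Submodule.map_span] at this
      exact Submodule.span_le_restrictScalars D K _ this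
    have hfn : algebraMap D K (f ^ n) ≠ 0 := by
      simpa using fun h => absurd h (by
        simpa using hf)
    rw [map_smul, ← algebraMap_smul K (f ^ n)] at h1
    have := Submodule.smul_mem _ (algebraMap D K (f ^ n))⁻¹ h1
    rwa [smul_smul, inv_mul_cancel₀ hfn, one_smul] at this
  refine ⟨⟨(hfin.image i).toFinset, ?_⟩⟩
  rw [Set.Finite.coe_toFinset, eq_top_iff]
  rintro v -
  induction v with
  | zero => exact zero_mem _
  | add v w hv hw => exact add_mem hv hw
  | tmul k x =>
    have : k ⊗ₜ[D] x = k • i x := by simp [i, TensorProduct.smul_tmul']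
    rw [this]
    exact Submodule.smul_mem _ k (hi x)

theorem nontrivial_fractionRing_tensorProduct [Nontrivial M]
    (htf : ∀ (d : D) (x : M), d • x = 0 → d = 0 ∨ x = 0) :
    Nontrivial (FractionRing D ⊗[D] M) := by
  obtain ⟨x, hx⟩ := exists_ne (0 : M)
  have := (isLocalizedModule_iff_isBaseChange (nonZeroDivisors D) (FractionRing D) _).2
    (TensorProduct.isBaseChange D M (FractionRing D))
  refine ⟨TensorProduct.mk D (FractionRing D) M 1 x, 0, fun h => ?_⟩
  obtain ⟨d, hd⟩ := (IsLocalizedModule.eq_zero_iff (nonZeroDivisors D) _).1 h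
  exact (htf d x hd).elim (nonZeroDivisors.coe_ne_zero d) hx

open scoped commutatorElement in
theorem exists_pow_eq_one_of_commutator_scalar {Q : Type*} [Group Q] [Nontrivial M]
    (htf : ∀ (d : D) (x : M), d • x = 0 → d = 0 ∨ x = 0)
    [Module.Finite (FractionRing D) (FractionRing D ⊗[D] M)] (ρ : Q →* Module.End D M) {x y : Q}
    {t : D} (hxy : ρ ⁅x, y⁆ = t • 1) : ∃ k, 0 < k ∧ t ^ k = 1 := by
  let K := FractionRing D
  have := nontrivial_fractionRing_tensorProduct htf
  let φ : Q →* K := (LinearMap.det (A := K) (M := K ⊗[D] M)).comp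
    ((Module.End.baseChangeHom D K M : Module.End D M →* Module.End K (K ⊗[D] M)).comp ρ)
  have h1 : φ ⁅x, y⁆ = 1 := by
    rw [← MonoidHom.coe_toHomUnits φ, map_commutatorElement,
      commutatorElement_eq_one_iff_mul_comm.2 (mul_comm _ _), Units.val_one]
  have h2 : φ ⁅x, y⁆ = algebraMap D K t ^ Module.finrank K (K ⊗[D] M) := by
    change LinearMap.det (Module.End.baseChangeHom D K M (ρ ⁅x, y⁆)) = _
    rw [hxy, map_smul, map_one, ← algebraMap_smul K t, LinearMap.det_smul, map_one, mul_one]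
  refine ⟨Module.finrank K (K ⊗[D] M), Module.finrank_pos, ?_⟩
  apply IsFractionRing.injective D K
  rw [map_pow, ← h2, h1, map_one]

open scoped commutatorElement in
/-- A commutator acting on a torsion-free module as a scalar of infinite order excludes that all
reductions of the module modulo maximal ideals are finite. -/
theorem false_of_commutator_scalar {Q : Type*} [Group Q] [Group.FG Q] [Nontrivial M]
    [Algebra.FiniteType ℤ D] (htf : ∀ (d : D) (x : M), d • x = 0 → d = 0 ∨ x = 0)
    (ρ : Q →* Module.End D M) {A : Subgroup Q} {c : ℕ}
    (hA : (⊤ : Subgroup Q).lowerCentralSeries c ≤ A) (htriv : ∀ a ∈ A, ρ a = 1) {F : Set M}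
    (hF : F.Finite) (hFtop : orbitSpan ρ ⊤ F = ⊤) {x y : Q} {t : D} (hxy : ρ ⁅x, y⁆ = t • 1)
    (ht : ∀ k, 0 < k → t ^ k ≠ 1)
    (hfin : ∀ m : Ideal D, m.IsMaximal → Finite (D ⧸ m) →
      Finite (M ⧸ m • (⊤ : Submodule D M))) : False := by
  have : IsNoetherianRing D := Algebra.FiniteType.isNoetherianRing ℤ D
  have hH : HallCondition ρ F ⊤ := polycyclic_induction hA
    (hallCondition_of_trivial hF htriv) fun _ _ _ hy h => h.sup_zpowers hy
  obtain ⟨f, hf, s, -, hs, hspan⟩ := hH.free ⊥ IsStableUnder.bot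
  simp only [hFtop, sup_bot_eq, Submodule.mem_top, true_implies] at hs hspan
  obtain ⟨m, hm, hmfin, hfm⟩ := exists_isMaximal_notMem_of_finiteType_int hf
  have := hfin m hm hmfin
  have hsfin : s.Finite := finite_of_linearIndepOn_of_finite_quotient hfm
    (linearIndepOn_iff.2 fun l hl h => hs l hl h) hspan
  have := finite_fractionRing_tensorProduct hf hsfin hspan
  obtain ⟨k, hk, e⟩ := exists_pow_eq_one_of_commutator_scalar htf ρ hxy
  exact ht k hk e

end FreeAwayFinite

section VirtuallyNilpotentMod

open Subgroup
open scoped commutatorElement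

variable {Q R : Type*} [Group Q] [Group R]

/-- Some subgroup of finite index has a term of its lower central series contained in `K`. -/
def VirtuallyNilpotentMod (K : Subgroup Q) : Prop :=
  ∃ L : Subgroup Q, L.FiniteIndex ∧ ∃ n, L.lowerCentralSeries n ≤ K

theorem virtuallyNilpotent_iff_mod_bot :
    VirtuallyNilpotent Q ↔ VirtuallyNilpotentMod (⊥ : Subgroup Q) := by
  simp only [VirtuallyNilpotent, VirtuallyNilpotentMod, isNilpotent_iff_lowerCentralSeries,
    le_bot_iff]

namespace VirtuallyNilpotentMod

theorem mono {K K' : Subgroup Q} (h : VirtuallyNilpotentMod K) (hK : K ≤ K') :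
    VirtuallyNilpotentMod K' := by
  obtain ⟨L, hL, n, hn⟩ := h
  exact ⟨L, hL, n, hn.trans hK⟩

theorem exists_normal {K : Subgroup Q} (h : VirtuallyNilpotentMod K) :
    ∃ L : Subgroup Q, L.Normal ∧ L.FiniteIndex ∧ ∃ n, L.lowerCentralSeries n ≤ K := by
  obtain ⟨L, hL, n, hn⟩ := h
  exact ⟨L.normalCore, inferInstance, inferInstance, n,
    (lowerCentralSeries_mono n L.normalCore_le).trans hn⟩

theorem comap_iff {π : Q →* R} (hπ : Function.Surjective π) {K : Subgroup R} :
    VirtuallyNilpotentMod (K.comap π) ↔ VirtuallyNilpotentMod K := by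
  constructor
  · rintro ⟨L, hL, n, hn⟩
    refine ⟨L.map π, ⟨?_⟩, n, ?_⟩
    · exact fun h => hL.index_ne_zero (zero_dvd_iff.1 (h ▸ L.index_map_dvd hπ))
    · rw [← map_lowerCentralSeries]
      exact map_le_iff_le_comap.2 hn
  · rintro ⟨L, hL, n, hn⟩
    refine ⟨L.comap π, ⟨?_⟩, n, ?_⟩
    · rw [index_comap_of_surjective _ hπ]
      exact hL.index_ne_zero
    · rw [← map_le_iff_le_comap, map_lowerCentralSeries]
      exact (lowerCentralSeries_mono n (map_comap_le π L)).trans hn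

end VirtuallyNilpotentMod

theorem virtuallyNilpotent_iff_ker {π : Q →* R} (hπ : Function.Surjective π) :
    VirtuallyNilpotent R ↔ VirtuallyNilpotentMod π.ker := by
  rw [virtuallyNilpotent_iff_mod_bot, ← VirtuallyNilpotentMod.comap_iff hπ,
    MonoidHom.comap_bot]

theorem VirtuallyNilpotent.of_surjective (h : VirtuallyNilpotent Q) {π : Q →* R}
    (hπ : Function.Surjective π) : VirtuallyNilpotent R :=
  (virtuallyNilpotent_iff_ker hπ).2 ((virtuallyNilpotent_iff_mod_bot.1 h).mono bot_le)

theorem VirtuallyNilpotent.of_finiteIndex {H : Subgroup Q} [H.FiniteIndex]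
    (h : VirtuallyNilpotent H) : VirtuallyNilpotent Q := by
  rw [virtuallyNilpotent_iff_mod_bot] at h ⊢
  obtain ⟨L, hL, n, hn⟩ := h
  refine ⟨L.map H.subtype, ⟨?_⟩, n, ?_⟩
  · rw [index_map_subtype]
    exact mul_ne_zero hL.index_ne_zero FiniteIndex.index_ne_zero
  · rw [← map_lowerCentralSeries, le_bot_iff, le_bot_iff.1 hn, Subgroup.map_bot]

/-- An equivariant endomorphism of a normal subgroup of a group which is virtually nilpotent
modulo its kernel and modulo its image. -/
theorem virtuallyNilpotent_of_endomorphism {A : Subgroup Q} [A.Normal] (φ : A →* A)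
    (hφ : ∀ (q : Q) (a : A), φ (MulAut.conjNormal q a) = MulAut.conjNormal q (φ a))
    (hker : VirtuallyNilpotentMod (φ.ker.map A.subtype))
    (hrange : VirtuallyNilpotentMod (φ.range.map A.subtype)) : VirtuallyNilpotent Q := by
  obtain ⟨L₁, hL₁n, hL₁, n₁, hn₁⟩ := hker.exists_normal
  obtain ⟨L₂, hL₂n, hL₂, n₂, hn₂⟩ := hrange.exists_normal
  let L := L₁ ⊓ L₂
  have hLn : L.Normal := inferInstance
  let B : ℕ → Subgroup Q := fun k => Nat.rec A (fun _ S => ⁅S, L⁆) k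
  have hBA : ∀ k, B k ≤ A := by
    intro k
    induction k with
    | zero => exact le_rfl
    | succ k ih => exact (commutator_mono ih le_rfl).trans (commutator_le_left A L)
  have hBL : ∀ k, B (k + 1) ≤ L.lowerCentralSeries k := by
    intro k
    induction k with
    | zero => exact commutator_le_right A L
    | succ k ih => exact commutator_mono ih le_rfl
  let S : ℕ → Subgroup Q := fun k => ((B k).subgroupOf A).map (A.subtype.comp φ)
  have hS : ∀ k, L.lowerCentralSeries (n₂ + k) ≤ S k := by
    intro k
    induction k with
    | zero =>
      refine (lowerCentralSeries_mono n₂ inf_le_right).trans (hn₂.trans ?_)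
      rintro _ ⟨_, ⟨a, rfl⟩, rfl⟩
      exact ⟨a, a.2, rfl⟩
    | succ k ih =>
      rw [← add_assoc, Subgroup.lowerCentralSeries_succ, commutator_le]
      intro g hg h hh
      obtain ⟨a, ha, rfl⟩ := ih hg
      refine ⟨a * MulAut.conjNormal h a⁻¹, ?_, ?_⟩
      · have : ⁅(a : Q), h⁆ ∈ B (k + 1) := commutator_mem_commutator ha hh
        simpa [mem_subgroupOf, commutatorElement_def, mul_assoc] using this
      · simp [hφ, commutatorElement_def, mul_assoc]
  rw [virtuallyNilpotent_iff_mod_bot]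
  refine ⟨L, inferInstance, n₂ + (n₁ + 1), (hS _).trans ?_⟩
  rintro _ ⟨a, ha, rfl⟩
  obtain ⟨b, hb, e⟩ := hn₁ (lowerCentralSeries_mono n₁ inf_le_left (hBL n₁ ha))
  obtain rfl : b = a := Subtype.ext e
  simp [MonoidHom.mem_ker.1 hb]

end VirtuallyNilpotentMod

section AbelianNormalSubgroup

open Subgroup Additive
open scoped commutatorElement IsMulCommutative

variable {Q : Type*} [Group Q] {A : Subgroup Q}

/-- The subgroup of the whole group given by an additive subgroup of `Additive A`. -/
def ambientSubgroup (C : AddSubgroup (Additive A)) : Subgroup Q :=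
  (AddSubgroup.toSubgroup' C).map A.subtype

theorem mem_ambientSubgroup {C : AddSubgroup (Additive A)} {q : Q} :
    q ∈ ambientSubgroup C ↔ ∃ h : q ∈ A, ofMul (⟨q, h⟩ : A) ∈ C := by
  constructor
  · rintro ⟨a, ha, rfl⟩
    exact ⟨a.2, ha⟩
  · rintro ⟨h, hq⟩
    exact ⟨⟨q, h⟩, hq, rfl⟩

theorem coe_mem_ambientSubgroup {C : AddSubgroup (Additive A)} {a : A} :
    (a : Q) ∈ ambientSubgroup C ↔ ofMul a ∈ C := by
  simp [mem_ambientSubgroup]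

theorem ambientSubgroup_le (C : AddSubgroup (Additive A)) : ambientSubgroup C ≤ A :=
  fun _ hq => (mem_ambientSubgroup.1 hq).1

theorem ambientSubgroup_mono : Monotone (ambientSubgroup (A := A)) := fun _ _ h _ hq =>
  let ⟨ha, hq⟩ := mem_ambientSubgroup.1 hq
  mem_ambientSubgroup.2 ⟨ha, h hq⟩

theorem ambientSubgroup_normal [A.Normal] {C : AddSubgroup (Additive A)}
    (hC : ∀ (q : Q) (a : A), ofMul a ∈ C → ofMul (MulAut.conjNormal q a) ∈ C) :
    (ambientSubgroup C).Normal := by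
  refine ⟨fun n hn q => ?_⟩
  obtain ⟨h, hn⟩ := mem_ambientSubgroup.1 hn
  exact coe_mem_ambientSubgroup.2 (hC q _ hn)

theorem eq_top_of_le_ambientSubgroup {C : AddSubgroup (Additive A)} (h : A ≤ ambientSubgroup C) :
    C = ⊤ :=
  eq_top_iff.2 fun a _ => coe_mem_ambientSubgroup.1 (h (a.toMul).2)

theorem finite_additive_of_finite {T : Set Q} (hT : T.Finite) :
    {a : Additive A | (a.toMul : Q) ∈ T}.Finite :=
  hT.preimage fun _ _ _ _ e => Subtype.ext e

variable [A.Normal] [IsMulCommutative A]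

/-- A group acting by conjugation on an abelian normal subgroup commutes with `D`. -/
def CommutesWithConj (D : Type*) [CommRing D] (A : Subgroup Q) [A.Normal] [IsMulCommutative A]
    [Module D (Additive A)] : Prop :=
  ∀ (d : D) (q : Q) (a : A), d • ofMul (MulAut.conjNormal q a) =
    ofMul (MulAut.conjNormal q (d • ofMul a).toMul)

variable {D : Type*} [CommRing D] [Module D (Additive A)]

/-- The conjugation action on an abelian normal subgroup, as a linear representation. -/
def conjRep (h : CommutesWithConj D A) : Q →* Module.End D (Additive A) where
  toFun q :=
    { toFun := fun a => ofMul (MulAut.conjNormal q a.toMul)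
      map_add' := fun a b => by simp
      map_smul' := fun d a => (h d q a.toMul).symm }
  map_one' := by ext a; simp
  map_mul' p q := by ext a; simp

theorem conjRep_eq_one (h : CommutesWithConj D A) {q : Q} (hq : q ∈ A) : conjRep h q = 1 := by
  refine LinearMap.ext fun a => ?_
  have : MulAut.conjNormal q a.toMul = a.toMul := by
    ext
    have := congrArg Subtype.val (mul_comm ⟨q, hq⟩ a.toMul)
    simpa [mul_inv_eq_iff_eq_mul] using this
  exact congrArg ofMul this

theorem ambientSubgroup_normal_of_isStableUnder (h : CommutesWithConj D A)
    {C : Submodule D (Additive A)} (hC : IsStableUnder (conjRep h) ⊤ C) :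
    (ambientSubgroup C.toAddSubgroup).Normal :=
  ambientSubgroup_normal fun q _ ha => hC q (mem_top q) _ ha

theorem orbitSpan_eq_top (h : CommutesWithConj D A) {T : Set Q} (hT : A = normalClosure T) :
    orbitSpan (conjRep h) ⊤ {a : Additive A | (a.toMul : Q) ∈ T} = ⊤ := by
  have := ambientSubgroup_normal_of_isStableUnder h
    (isStableUnder_orbitSpan (F := {a : Additive A | (a.toMul : Q) ∈ T}))
  have hle : A ≤ ambientSubgroup
      (orbitSpan (conjRep h) ⊤ {a : Additive A | (a.toMul : Q) ∈ T}).toAddSubgroup := by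
    conv_lhs => rw [hT]
    refine normalClosure_le_normal fun t ht => ?_
    have htA : t ∈ A := hT ▸ subset_normalClosure ht
    exact mem_ambientSubgroup.2 ⟨htA, Submodule.subset_span
      ⟨1, one_mem _, ofMul ⟨t, htA⟩, by simpa using ht, by rw [map_one, Module.End.one_apply]⟩⟩
  exact Submodule.toAddSubgroup_injective (eq_top_of_le_ambientSubgroup hle)

end AbelianNormalSubgroup

section MinimalCounterexample

open Subgroup Additive
open scoped commutatorElement IsMulCommutative

variable {Q : Type*} [Group Q] {A : Subgroup Q} [A.Normal] [IsMulCommutative A]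
  {D : Type*} [CommRing D] [Module D (Additive A)]

theorem eq_zero_or_eq_zero_of_smul_eq_zero (hQ : ¬ VirtuallyNilpotent Q)
    (hmin : ∀ K : Subgroup Q, K.Normal → K ≤ A → K ≠ ⊥ → VirtuallyNilpotentMod K)
    (hfaith : ∀ d : D, (∀ a : Additive A, d • a = 0) → d = 0) (h : CommutesWithConj D A)
    (d : D) (x : Additive A) (hx : d • x = 0) : d = 0 ∨ x = 0 := by
  by_contra! hne
  obtain ⟨y, hy⟩ := not_forall.1 (mt (hfaith d) hne.1)
  let φ : A →* A :=
    { toFun := fun a => (d • ofMul a).toMul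
      map_one' := by simp
      map_mul' := fun a b => by simp }
  have hφ : ∀ (q : Q) (a : A), φ (MulAut.conjNormal q a) = MulAut.conjNormal q (φ a) :=
    fun q a => h d q a
  have hxk : (x.toMul : Q) ∈ φ.ker.map A.subtype := ⟨x.toMul, hx, rfl⟩
  have hyr : ((d • y).toMul : Q) ∈ φ.range.map A.subtype := ⟨_, ⟨y.toMul, rfl⟩, rfl⟩
  refine hQ (virtuallyNilpotent_of_endomorphism φ hφ (hmin _ ⟨?_⟩ (map_subtype_le _) ?_)
    (hmin _ ⟨?_⟩ (map_subtype_le _) ?_))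
  · rintro _ ⟨a, ha, rfl⟩ q
    refine ⟨MulAut.conjNormal q a, ?_, rfl⟩
    rw [SetLike.mem_coe, MonoidHom.mem_ker, hφ, MonoidHom.mem_ker.1 ha, map_one]
  · exact fun e => hne.2 (congrArg ofMul (Subtype.ext (mem_bot.1 (e ▸ hxk)) : x.toMul = 1))
  · rintro _ ⟨_, ⟨a, rfl⟩, rfl⟩ q
    exact ⟨MulAut.conjNormal q (φ a), ⟨MulAut.conjNormal q a, hφ q a⟩, rfl⟩
  · exact fun e => hy (congrArg ofMul (Subtype.ext (mem_bot.1 (e ▸ hyr)) : (d • y).toMul = 1))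

omit [A.Normal] in
theorem finite_quotient_smul_top [Group.FG Q] {m : Ideal D} [Finite (D ⧸ m)]
    (hJ : VirtuallyNilpotentMod
      (ambientSubgroup (m • (⊤ : Submodule D (Additive A))).toAddSubgroup)) :
    Finite (Additive A ⧸ m • (⊤ : Submodule D (Additive A))) := by
  set J := m • (⊤ : Submodule D (Additive A)) with hJdef
  obtain ⟨L, hL, n, hn⟩ := hJ
  obtain ⟨T, hT, hTe⟩ := exists_finite_eq_sup_closure_of_finiteIndex hn (ambientSubgroup_le _)
  have hTA : T ⊆ A := by
    rw [hTe]
    exact Set.Subset.trans Subgroup.subset_closure (SetLike.coe_subset_coe.2 le_sup_right)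
  let S : Set (Additive A ⧸ J) := J.mkQ '' {a : Additive A | (a.toMul : Q) ∈ T}
  have hS : S.Finite := (finite_additive_of_finite hT).image _
  have htop : (AddSubgroup.closure S).comap J.mkQ.toAddMonoidHom = ⊤ := by
    refine eq_top_of_le_ambientSubgroup ?_
    conv_lhs => rw [hTe]
    refine sup_le (ambientSubgroup_mono fun a ha => ?_) ((Subgroup.closure_le _).2 fun q hq => ?_)
    · rw [AddSubgroup.mem_comap]
      have : J.mkQ a = 0 := (Submodule.Quotient.mk_eq_zero J).2 ha
      exact this ▸ zero_mem _
    · exact mem_ambientSubgroup.2 ⟨hTA hq, AddSubgroup.subset_closure ⟨_, hq, rfl⟩⟩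
  have hfg : AddGroup.FG (Additive A ⧸ J) := by
    refine AddGroup.fg_iff.2 ⟨S, eq_top_iff.2 fun v _ => ?_, hS⟩
    obtain ⟨a, rfl⟩ := J.mkQ_surjective v
    exact htop.ge (AddSubgroup.mem_top a)
  refine AddCommGroup.finite_of_fg_isAddTorsion _ fun v => ?_
  obtain ⟨a, rfl⟩ := J.mkQ_surjective v
  rw [isOfFinAddOrder_iff_nsmul_eq_zero]
  refine ⟨Nat.card (D ⧸ m), Nat.card_pos, ?_⟩
  have hmem : (Nat.card (D ⧸ m) : D) ∈ m := by
    rw [← Ideal.Quotient.eq_zero_iff_mem, map_natCast]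
    have := card_nsmul_eq_zero' (x := (1 : D ⧸ m))
    rwa [nsmul_one] at this
  rw [← map_nsmul, Submodule.mkQ_apply, Submodule.Quotient.mk_eq_zero, ← Nat.cast_smul_eq_nsmul D]
  exact Submodule.smul_mem_smul hmem Submodule.mem_top

theorem false_of_commutator_of_minimal [Group.FG Q] [Algebra.FiniteType ℤ D] {c : ℕ}
    (hA : (⊤ : Subgroup Q).lowerCentralSeries c ≤ A) (hQ : ¬ VirtuallyNilpotent Q)
    (hmin : ∀ K : Subgroup Q, K.Normal → K ≤ A → K ≠ ⊥ → VirtuallyNilpotentMod K)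
    (hfaith : ∀ d : D, (∀ a : Additive A, d • a = 0) → d = 0) (h : CommutesWithConj D A)
    {x y : Q} {t : D} (ht : ∀ a : A, t • ofMul a = ofMul (MulAut.conjNormal ⁅x, y⁆ a))
    (hxy : ∀ k, 0 < k → ∃ a : A, MulAut.conjNormal (⁅x, y⁆ ^ k) a ≠ a) : False := by
  have htf := eq_zero_or_eq_zero_of_smul_eq_zero hQ hmin hfaith h
  have hnt : Nontrivial (Additive A) := by
    obtain ⟨a, ha⟩ := hxy 1 one_pos
    exact ⟨ofMul (MulAut.conjNormal (⁅x, y⁆ ^ 1) a), ofMul a, ha⟩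
  obtain ⟨v, hv⟩ := exists_ne (0 : Additive A)
  have : Nontrivial D := ⟨1, 0, fun e => hv (by rw [← one_smul D v, e, zero_smul])⟩
  have : NoZeroDivisors D := ⟨fun {a b} e => by
    have := htf a (b • v) (by rw [smul_smul, e, zero_smul])
    exact this.imp_right fun hb => (htf b v hb).resolve_right hv⟩
  have : IsDomain D := NoZeroDivisors.to_isDomain D
  have hpow : ∀ k (a : A), t ^ k • ofMul a = ofMul (MulAut.conjNormal (⁅x, y⁆ ^ k) a) := by
    intro k
    induction k with
    | zero => intro a; simp
    | succ k ih =>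
      intro a
      rw [pow_succ, mul_smul, ht, ih, pow_succ, map_mul, MulAut.mul_apply]
  have htk : ∀ k, 0 < k → t ^ k ≠ 1 := by
    intro k hk e
    obtain ⟨a, ha⟩ := hxy k hk
    have := hpow k a
    rw [e, one_smul] at this
    exact ha (ofMul.injective this).symm
  have ht0 : t ≠ 0 := by
    rintro rfl
    have := ht v.toMul
    rw [zero_smul] at this
    have h1 : MulAut.conjNormal ⁅x, y⁆ v.toMul = 1 := ofMul.injective this.symm
    rw [map_eq_one_iff _ (MulEquiv.injective _)] at h1
    exact hv (congrArg ofMul h1)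
  obtain ⟨T, hT, hTe⟩ := exists_finite_eq_normalClosure hA
  refine false_of_commutator_scalar htf (conjRep h) hA (fun a ha => conjRep_eq_one h ha)
    (finite_additive_of_finite hT) (orbitSpan_eq_top h hTe) (x := x) (y := y) (t := t)
    (LinearMap.ext fun a => (ht a.toMul).symm) htk fun m hm hmfin => ?_
  refine finite_quotient_smul_top (hmin _ (ambientSubgroup_normal_of_isStableUnder h ?_)
    (ambientSubgroup_le _) ?_)
  · intro q _ a ha
    refine Submodule.smul_induction_on ha (fun r hr n _ => ?_) fun a b ha hb => ?_
    · rw [map_smul]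
      exact Submodule.smul_mem_smul hr Submodule.mem_top
    · rw [map_add]
      exact add_mem ha hb
  · intro e
    have hm0 : m = ⊥ := by
      refine (Submodule.eq_bot_iff _).2 fun d hd => ?_
      refine (htf d v ?_).resolve_right hv
      have : ((d • v).toMul : Q) ∈ ambientSubgroup
          (m • (⊤ : Submodule D (Additive A))).toAddSubgroup :=
        coe_mem_ambientSubgroup.2 (Submodule.smul_mem_smul hd Submodule.mem_top)
      rw [e, mem_bot] at this
      exact congrArg ofMul (Subtype.ext this : (d • v).toMul = 1)
    subst hm0
    have : Finite D := Finite.of_injective _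
      ((RingHom.injective_iff_ker_eq_bot (Ideal.Quotient.mk (⊥ : Ideal D))).2 Ideal.mk_ker)
    obtain ⟨i, j, hij, e⟩ := Finite.exists_ne_map_eq_of_infinite fun k : ℕ => t ^ k
    wlog hlt : i < j generalizing i j
    · exact this j i hij.symm e.symm (by omega)
    refine htk (j - i) (by omega) (mul_left_cancel₀ (pow_ne_zero i ht0) ?_)
    rw [← pow_add, mul_one, Nat.add_sub_cancel' hlt.le]
    exact e.symm

omit [Module D (Additive A)] in
/-- In a minimal counterexample, commutators that are central modulo `A` have a power
centralizing `A`. -/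
theorem exists_pow_commutator_centralizes [Group.FG Q] {c : ℕ}
    (hA : (⊤ : Subgroup Q).lowerCentralSeries c ≤ A) (hQ : ¬ VirtuallyNilpotent Q)
    (hmin : ∀ K : Subgroup Q, K.Normal → K ≤ A → K ≠ ⊥ → VirtuallyNilpotentMod K)
    {x y : Q} (hxy : ∀ q, ⁅⁅x, y⁆, q⁆ ∈ A) :
    ∃ k, 0 < k ∧ ∀ a ∈ A, ⁅x, y⁆ ^ k * a = a * ⁅x, y⁆ ^ k := by
  by_contra! hcon
  have h₀ : CommutesWithConj ℤ A := fun d q a => by simp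
  let ρ := conjRep h₀
  let ζ : Module.End ℤ (Additive A) := ρ ⁅x, y⁆
  have hζ : ∀ q, Commute ζ (ρ q) := fun q => by
    have h1 : ⁅x, y⁆ * q = ⁅⁅x, y⁆, q⁆ * (q * ⁅x, y⁆) := by
      simp [commutatorElement_def, mul_assoc]
    rw [commute_iff_eq, ← map_mul, h1, map_mul, conjRep_eq_one h₀ (hxy q), one_mul, map_mul]
  let ev : Polynomial ℤ →+* Module.End ℤ (Additive A) := (Polynomial.aeval ζ).toRingHom
  have hev : ∀ p q, Commute (ev p) (ρ q) := fun p q => by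
    induction p using Polynomial.induction_on' with
    | add p r hp hr => rw [map_add]; exact hp.add_left hr
    | monomial n a =>
      change Commute (Polynomial.aeval ζ (Polynomial.monomial n a)) (ρ q)
      rw [Polynomial.aeval_monomial]
      exact (show Commute _ _ from Algebra.commutes a (ρ q)).mul_left ((hζ q).pow_left n)
  let D := Polynomial ℤ ⧸ RingHom.ker ev
  let θ : D →+* Module.End ℤ (Additive A) := RingHom.kerLift ev
  let _ : Module D (Additive A) := Module.compHom (Additive A) θ
  have hsmul : ∀ (d : D) (a : Additive A), d • a = θ d a := fun _ _ => rfl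
  let _ : Algebra ℤ D := Ring.toIntAlgebra D
  let π : Polynomial ℤ →ₐ[ℤ] D :=
    { Ideal.Quotient.mk (RingHom.ker ev) with commutes' := fun n => by simp }
  have : Algebra.FiniteType ℤ D := Algebra.FiniteType.of_surjective π Ideal.Quotient.mk_surjective
  refine false_of_commutator_of_minimal (D := D) (x := x) (y := y)
    (t := Ideal.Quotient.mk _ Polynomial.X) hA hQ hmin (fun d hd => ?_) (fun d q a => ?_)
    (fun a => ?_) fun k hk => ?_
  · apply RingHom.kerLift_injective ev
    rw [map_zero]
    exact LinearMap.ext hd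
  · obtain ⟨p, rfl⟩ := Ideal.Quotient.mk_surjective d
    exact LinearMap.congr_fun (hev p q) (ofMul a)
  · rw [hsmul]
    exact LinearMap.congr_fun (Polynomial.aeval_X ζ) (ofMul a)
  · obtain ⟨a, ha, hne⟩ := hcon k hk
    refine ⟨⟨a, ha⟩, fun e => hne ?_⟩
    have := congrArg Subtype.val e
    rwa [MulAut.conjNormal_apply, mul_inv_eq_iff_eq_mul] at this

end MinimalCounterexample

section MetabelianQuotients

open Subgroup Additive
open scoped commutatorElement IsMulCommutative

/-- Every metabelian quotient of every subgroup of finite index is virtually nilpotent. -/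
def MetabelianQuotientsVirtuallyNilpotent (Q : Type*) [Group Q] : Prop :=
  ∀ H : Subgroup Q, H.FiniteIndex → ∀ (N : Subgroup H) [N.Normal],
    derivedSeries (H ⧸ N) 2 = ⊥ → VirtuallyNilpotent (H ⧸ N)

namespace MetabelianQuotientsVirtuallyNilpotent

variable {Q R : Type*} [Group Q] [Group R]

theorem virtuallyNilpotent_of_surjective (h : MetabelianQuotientsVirtuallyNilpotent Q)
    {H : Subgroup Q} (hH : H.FiniteIndex) {f : H →* R} (hf : Function.Surjective f)
    (hR : derivedSeries R 2 = ⊥) : VirtuallyNilpotent R := by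
  let e := QuotientGroup.quotientKerEquivOfSurjective f hf
  refine (h H hH f.ker ?_).of_surjective (π := e.toMonoidHom) e.surjective
  rw [← map_derivedSeries_eq (f := e.symm.toMonoidHom) e.symm.surjective, hR, Subgroup.map_bot]

theorem of_surjective (h : MetabelianQuotientsVirtuallyNilpotent Q) {π : Q →* R}
    (hπ : Function.Surjective π) : MetabelianQuotientsVirtuallyNilpotent R := by
  intro H hH N _ hN
  refine h.virtuallyNilpotent_of_surjective (H := H.comap π) ⟨?_⟩
    (f := (QuotientGroup.mk' N).comp (π.subgroupComap H)) ?_ hN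
  · rw [index_comap_of_surjective _ hπ]
    exact hH.index_ne_zero
  · exact (QuotientGroup.mk'_surjective N).comp
      (π.subgroupComap_surjective_of_surjective H hπ)

theorem of_finiteIndex (h : MetabelianQuotientsVirtuallyNilpotent Q) (H : Subgroup Q)
    [hH : H.FiniteIndex] : MetabelianQuotientsVirtuallyNilpotent H := by
  intro K hK N _ hN
  let e := K.equivMapOfInjective H.subtype H.subtype_injective
  refine h.virtuallyNilpotent_of_surjective (H := K.map H.subtype) ⟨?_⟩
    (f := (QuotientGroup.mk' N).comp e.symm.toMonoidHom) ?_ hN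
  · rw [index_map_subtype]
    exact mul_ne_zero hK.index_ne_zero hH.index_ne_zero
  · exact (QuotientGroup.mk'_surjective N).comp e.symm.surjective

end MetabelianQuotientsVirtuallyNilpotent

variable {Q : Type*} [Group Q]

theorem finiteIndex_centralizer_of_isOfFinOrder [Group.FG Q] {x : Q}
    (hcen : ∀ q : Q, ⁅x, q⁆ ∈ center Q) (htor : ∀ q : Q, IsOfFinOrder ⁅x, q⁆) :
    (centralizer {x}).FiniteIndex := by
  let f : Q →* center Q := MonoidHom.mk' (fun q => ⟨⁅x, q⁆, hcen q⟩) fun a b => by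
    ext
    have := mem_center_iff.1 (hcen b) a
    have e : ⁅x, a * b⁆ = ⁅x, a⁆ * (a * ⁅x, b⁆) * a⁻¹ := by
      simp [commutatorElement_def, mul_assoc]
    simp [e, this, mul_assoc]
  have hker : f.ker = centralizer {x} := by
    ext q
    rw [MonoidHom.mem_ker, mem_centralizer_singleton_iff, eq_comm (a := q * x),
      ← commutatorElement_eq_one_iff_mul_comm]
    exact Subtype.ext_iff
  have : Finite f.range := CommGroup.finite_of_fg_isMulTorsion _ <| by
    rintro ⟨_, q, rfl⟩
    exact f.range.subtype_injective.isOfFinOrder_iff.1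
      ((center Q).subtype_injective.isOfFinOrder_iff.1 (htor q))
  rw [← hker]
  infer_instance

theorem finiteIndex_centralizer_of_finite [Group.FG Q] {T : Set Q} (hT : T.Finite)
    (hcen : ∀ x ∈ T, ∀ q : Q, ⁅x, q⁆ ∈ center Q) (htor : ∀ x ∈ T, ∀ q : Q, IsOfFinOrder ⁅x, q⁆) :
    (centralizer T).FiniteIndex := by
  induction T, hT using Set.Finite.induction_on with
  | empty =>
    have : centralizer (∅ : Set Q) = ⊤ := by
      ext q
      simp [mem_centralizer_iff]
    rw [this]
    infer_instance
  | @insert x T _ _ ih =>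
    have h1 := finiteIndex_centralizer_of_isOfFinOrder (hcen x (Set.mem_insert x T))
      (htor x (Set.mem_insert x T))
    have h2 := ih (fun y hy => hcen y (Set.mem_insert_of_mem x hy))
      (fun y hy => htor y (Set.mem_insert_of_mem x hy))
    have : centralizer (insert x T) = centralizer {x} ⊓ centralizer T := by
      ext q
      simp [mem_centralizer_iff]
    rw [this]
    infer_instance

theorem exists_finiteIndex_lowerCentralSeries_eq_bot [Group.FG Q] {c : ℕ}
    (hc : (⊤ : Subgroup Q).lowerCentralSeries (c + 2) = ⊥)
    (htor : ∀ x ∈ (⊤ : Subgroup Q).lowerCentralSeries c, ∀ q : Q, IsOfFinOrder ⁅x, q⁆) :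
    ∃ C : Subgroup Q, C.FiniteIndex ∧ C.lowerCentralSeries (c + 1) = ⊥ := by
  obtain ⟨T, hT, hTc⟩ := exists_finite_lowerCentralSeries_eq_normalClosure (Q := Q) c
  have hTle : ∀ x ∈ T, x ∈ (⊤ : Subgroup Q).lowerCentralSeries c := fun x hx =>
    hTc ▸ subset_normalClosure hx
  have hfin := finiteIndex_centralizer_of_finite hT (fun x hx q => ?_) fun x hx =>
    htor x (hTle x hx)
  · refine ⟨(centralizer T).normalCore, inferInstance, ?_⟩
    rw [Subgroup.lowerCentralSeries_succ, commutator_eq_bot_iff_le_centralizer]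
    refine (lowerCentralSeries_mono c le_top).trans (hTc.trans_le ?_)
    refine normalClosure_le_normal fun x hx => mem_centralizer_iff.2 fun g hg => ?_
    exact (mem_centralizer_iff.1 (normalCore_le _ hg) x hx).symm
  · have h1 : ⁅x, q⁆ ∈ (⊤ : Subgroup Q).lowerCentralSeries (c + 1) :=
      commutator_mem_commutator (hTle x hx) (mem_top q)
    refine mem_center_iff.2 fun g => ?_
    have h2 : ⁅⁅x, q⁆, g⁆ ∈ (⊤ : Subgroup Q).lowerCentralSeries (c + 2) :=
      commutator_mem_commutator h1 (mem_top g)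
    rw [hc, mem_bot, commutatorElement_eq_one_iff_mul_comm] at h2
    exact h2.symm

theorem exists_forall_eq_of_monotone_of_le_abelian [Group.FG Q] {A : Subgroup Q} [A.Normal]
    [IsMulCommutative A] {c : ℕ} (hA : (⊤ : Subgroup Q).lowerCentralSeries c ≤ A)
    (K : ℕ → Subgroup Q) (hK : Monotone K) (hn : ∀ n, (K n).Normal) (hKA : ∀ n, K n ≤ A) :
    ∃ n₀, ∀ n ≥ n₀, K n = K n₀ := by
  have h₀ : CommutesWithConj ℤ A := fun d q a => by simp
  obtain ⟨T, hT, hTe⟩ := exists_finite_eq_normalClosure hA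
  have hH : HallCondition (conjRep h₀) {a : Additive A | (a.toMul : Q) ∈ T} ⊤ :=
    polycyclic_induction hA
      (hallCondition_of_trivial (finite_additive_of_finite hT) fun _ ha => conjRep_eq_one h₀ ha)
      fun _ _ _ hy h => h.sup_zpowers hy
  let C : ℕ → Submodule ℤ (Additive A) := fun n =>
    AddSubgroup.toIntSubmodule (Subgroup.toAddSubgroup ((K n).subgroupOf A))
  have hC : ∀ n (a : A), ofMul a ∈ C n ↔ (a : Q) ∈ K n := fun _ _ => Iff.rfl
  obtain ⟨n₀, h⟩ := hH.acc C (fun i j hij a ha => hK hij ha) fun n q _ a ha =>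
    (hn n).conj_mem _ ha q
  simp only [orbitSpan_eq_top h₀ hTe, inf_top_eq] at h
  refine ⟨n₀, fun n hn => SetLike.ext fun q => ?_⟩
  by_cases hq : q ∈ A
  · exact SetLike.ext_iff.1 (h n hn) (ofMul ⟨q, hq⟩)
  · exact ⟨fun hh => absurd (hKA _ hh) hq, fun hh => absurd (hKA _ hh) hq⟩

end MetabelianQuotients

section Reduction

open Subgroup
open scoped commutatorElement IsMulCommutative

theorem isMulCommutative_zpowers_sup {Q : Type*} [Group Q] {A : Subgroup Q} [IsMulCommutative A]
    {w : Q} (hw : ∀ a ∈ A, w * a = a * w) : IsMulCommutative ↥(zpowers w ⊔ A) := by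
  have hA : A ≤ centralizer (zpowers w : Set Q) := by
    rw [le_centralizer_iff, zpowers_le, mem_centralizer_iff]
    exact fun a ha => (hw a ha).symm
  have hA' : A ≤ centralizer (A : Set Q) := le_centralizer_iff_isMulCommutative.2 inferInstance
  have hw' : zpowers w ≤ centralizer (zpowers w : Set Q) :=
    le_centralizer_iff_isMulCommutative.2 inferInstance
  rw [← le_centralizer_iff_isMulCommutative]
  refine sup_le ?_ ?_ <;> rw [le_centralizer_iff]
  · exact sup_le hw' hA
  · exact sup_le (le_centralizer_iff.1 hA) hA'

theorem normal_zpowers_sup {Q : Type*} [Group Q] {A : Subgroup Q} [A.Normal] {w : Q}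
    (hw : ∀ q : Q, ⁅w, q⁆ ∈ A) : (zpowers w ⊔ A).Normal := by
  have hcen : zpowers (w : Q ⧸ A) ≤ center (Q ⧸ A) := by
    rw [zpowers_le, mem_center_iff]
    intro g
    induction g using QuotientGroup.induction_on with
    | H q =>
      have := (QuotientGroup.eq_one_iff _).2 (hw q)
      exact (commutatorElement_eq_one_iff_mul_comm.1 this).symm
  have : (zpowers (w : Q ⧸ A)).Normal := ⟨fun n hn g => by
    rwa [mem_center_iff.1 (hcen hn) g, mul_inv_cancel_right]⟩
  have h : (zpowers (w : Q ⧸ A)).comap (QuotientGroup.mk' A) = zpowers w ⊔ A := by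
    rw [← QuotientGroup.coe_mk', ← MonoidHom.map_zpowers, comap_map_eq, QuotientGroup.ker_mk']
  rw [← h]
  infer_instance

/-- The case of a minimal non-virtually nilpotent extension of a nilpotent group by a maximal
abelian normal subgroup. -/
theorem virtuallyNilpotent_of_minimal {Q : Type*} [Group Q] [Group.FG Q] {A : Subgroup Q}
    [A.Normal] [IsMulCommutative A] {c : ℕ}
    (hA : (⊤ : Subgroup Q).lowerCentralSeries (c + 2) ≤ A)
    (ih : ∀ C : Subgroup Q, C.FiniteIndex → C.lowerCentralSeries (c + 1) ≤ A →
      VirtuallyNilpotent C)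
    (hmin : ∀ K : Subgroup Q, K.Normal → K ≤ A → K ≠ ⊥ → VirtuallyNilpotentMod K)
    (hmax : ∀ B : Subgroup Q, B.Normal → IsMulCommutative B → A ≤ B → B = A) :
    VirtuallyNilpotent Q := by
  by_contra hQ
  let π := QuotientGroup.mk' A
  have hπ : Function.Surjective π := QuotientGroup.mk'_surjective A
  have htor : ∀ x ∈ (⊤ : Subgroup Q).lowerCentralSeries c, ∀ y : Q, IsOfFinOrder (π ⁅x, y⁆) := by
    intro x hx y
    have hxy : ∀ q : Q, ⁅⁅x, y⁆, q⁆ ∈ A := fun q =>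
      hA (commutator_mem_commutator (commutator_mem_commutator hx (mem_top y)) (mem_top q))
    obtain ⟨k, hk, hcomm⟩ := exists_pow_commutator_centralizes hA hQ hmin hxy
    have hw : ∀ q : Q, ⁅⁅x, y⁆ ^ k, q⁆ ∈ A := by
      intro q
      have h1 : Commute (π ⁅x, y⁆) (π q) := commutatorElement_eq_one_iff_mul_comm.1 <| by
        rw [← map_commutatorElement]
        exact (QuotientGroup.eq_one_iff _).2 (hxy q)
      refine (QuotientGroup.eq_one_iff _).1 (?_ : π _ = 1)
      rw [map_commutatorElement, map_pow, commutatorElement_eq_one_iff_mul_comm]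
      exact h1.pow_left k
    have hB := hmax _ (normal_zpowers_sup hw) (isMulCommutative_zpowers_sup hcomm) le_sup_right
    refine isOfFinOrder_iff_pow_eq_one.2 ⟨k, hk, ?_⟩
    rw [← map_pow]
    exact (QuotientGroup.eq_one_iff _).2 (hB.le (mem_sup_left (mem_zpowers _)))
  obtain ⟨C, hC, hCc⟩ := exists_finiteIndex_lowerCentralSeries_eq_bot (Q := Q ⧸ A) (c := c)
    (by
      rw [← MonoidHom.range_eq_top.2 hπ, MonoidHom.range_eq_map, ← map_lowerCentralSeries,
        Subgroup.map_eq_bot_iff, QuotientGroup.ker_mk']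
      exact hA)
    (by
      rw [← MonoidHom.range_eq_top.2 hπ, MonoidHom.range_eq_map, ← map_lowerCentralSeries]
      rintro _ ⟨x, hx, rfl⟩ q
      obtain ⟨y, rfl⟩ := hπ q
      rw [← map_commutatorElement]
      exact htor x hx y)
  have hfi : (C.comap π).FiniteIndex :=
    ⟨by rw [index_comap_of_surjective _ hπ]; exact hC.index_ne_zero⟩
  refine hQ (VirtuallyNilpotent.of_finiteIndex (ih (C.comap π) hfi ?_))
  refine le_of_le_of_eq ?_ (QuotientGroup.ker_mk' A)
  rw [← MonoidHom.comap_bot, ← map_le_iff_le_comap, map_lowerCentralSeries, ← hCc]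
  exact lowerCentralSeries_mono _ (map_comap_le _ _)

theorem wellFoundedGT_normal_between {Q : Type*} [Group Q] [Group.FG Q] {A : Subgroup Q}
    [A.Normal] {c : ℕ} (hA : (⊤ : Subgroup Q).lowerCentralSeries c ≤ A) :
    WellFoundedGT {K : Subgroup Q // K.Normal ∧ ⁅A, A⁆ ≤ K ∧ K ≤ A} := by
  rw [wellFoundedGT_iff_monotone_chain_condition]
  intro K
  let π := QuotientGroup.mk' ⁅A, A⁆
  have hπ : Function.Surjective π := QuotientGroup.mk'_surjective _
  have h1 : IsMulCommutative (A.map π) := by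
    rw [← le_centralizer_iff_isMulCommutative, ← commutator_eq_bot_iff_le_centralizer,
      ← map_commutator, Subgroup.map_eq_bot_iff, QuotientGroup.ker_mk']
  have h2 : (A.map π).Normal := Normal.map inferInstance π hπ
  have h3 : (⊤ : Subgroup (Q ⧸ ⁅A, A⁆)).lowerCentralSeries c ≤ A.map π := by
    rw [← MonoidHom.range_eq_top.2 hπ, MonoidHom.range_eq_map, ← map_lowerCentralSeries]
    exact map_mono hA
  obtain ⟨n₀, h⟩ := exists_forall_eq_of_monotone_of_le_abelian h3 (fun n => (K n).1.map π)
    (fun i j hij => map_mono (K.monotone hij)) (fun n => (K n).2.1.map π hπ)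
    fun n => map_mono (K n).2.2.2
  refine ⟨n₀, fun n hn => Subtype.ext ?_⟩
  have hker : ∀ m, ((K m).1.map π).comap π = (K m).1 := fun m =>
    comap_map_eq_self (by rw [QuotientGroup.ker_mk']; exact (K m).2.2.1)
  rw [← hker n, ← hker n₀]
  exact congrArg _ (h n hn).symm

/-- A group that is not virtually nilpotent has a quotient satisfying the hypotheses of
`virtuallyNilpotent_of_minimal`. -/
theorem exists_minimal_quotient {Q : Type*} [Group Q] [Group.FG Q] {A : Subgroup Q} [A.Normal]
    [IsMulCommutative A] {c : ℕ} (hA : (⊤ : Subgroup Q).lowerCentralSeries c ≤ A)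
    (hQ : ¬ VirtuallyNilpotent Q) :
    ∃ (K : Subgroup Q) (_ : K.Normal) (B : Subgroup (Q ⧸ K)), B.Normal ∧ IsMulCommutative B ∧
      (⊤ : Subgroup (Q ⧸ K)).lowerCentralSeries c ≤ B ∧ ¬ VirtuallyNilpotent (Q ⧸ K) ∧
      (∀ M : Subgroup (Q ⧸ K), M.Normal → M ≤ B → M ≠ ⊥ → VirtuallyNilpotentMod M) ∧
      ∀ M : Subgroup (Q ⧸ K), M.Normal → IsMulCommutative M → B ≤ M → M = B := by
  have := wellFoundedGT_subgroups_above hA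
  let S : Set {B : Subgroup Q // A ≤ B} := {B | B.1.Normal ∧
    ∃ K : Subgroup Q, K.Normal ∧ ⁅B.1, B.1⁆ ≤ K ∧ K ≤ B.1 ∧ ¬ VirtuallyNilpotentMod K}
  obtain ⟨⟨B, hAB⟩, ⟨hBn, K₁, hK₁n, hK₁, hK₁B, hK₁v⟩, hBmax⟩ :=
    WellFounded.has_min (wellFounded_gt (α := {B : Subgroup Q // A ≤ B})) S
      ⟨⟨A, le_rfl⟩, inferInstance, ⊥, inferInstance,
        (commutator_eq_bot_iff_le_centralizer.2
          (le_centralizer_iff_isMulCommutative.2 inferInstance)).le, bot_le,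
        by rwa [← virtuallyNilpotent_iff_mod_bot]⟩
  dsimp only at hBn hK₁ hK₁B
  have := wellFoundedGT_normal_between (hA.trans hAB)
  obtain ⟨⟨K, hKn, hBK, hKB⟩, hKv, hKmax⟩ :=
    WellFounded.has_min
      (wellFounded_gt (α := {K : Subgroup Q // K.Normal ∧ ⁅B, B⁆ ≤ K ∧ K ≤ B}))
      {K | ¬ VirtuallyNilpotentMod K.1} ⟨⟨K₁, hK₁n, hK₁, hK₁B⟩, hK₁v⟩
  let π := QuotientGroup.mk' K
  have hπ : Function.Surjective π := QuotientGroup.mk'_surjective K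
  have hker : π.ker = K := QuotientGroup.ker_mk' K
  refine ⟨K, hKn, B.map π, hBn.map π hπ, ?_, ?_, ?_, fun M hMn hMB hM => ?_,
    fun M hMn hMc hBM => ?_⟩
  · rw [← le_centralizer_iff_isMulCommutative, ← commutator_eq_bot_iff_le_centralizer,
      ← map_commutator, Subgroup.map_eq_bot_iff, hker]
    exact hBK
  · rw [← MonoidHom.range_eq_top.2 hπ, MonoidHom.range_eq_map, ← map_lowerCentralSeries]
    exact map_mono (hA.trans hAB)
  · rw [virtuallyNilpotent_iff_ker hπ, hker]
    exact hKv
  · rw [← VirtuallyNilpotentMod.comap_iff hπ]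
    by_contra hMv
    have hKM : K ≤ M.comap π := hker.ge.trans (ker_le_comap π M)
    have hMB' : M.comap π ≤ B :=
      (comap_mono hMB).trans (comap_map_eq_self (hker.trans_le hKB)).le
    refine hKmax ⟨M.comap π, inferInstance, hBK.trans hKM, hMB'⟩ hMv (lt_of_le_of_ne hKM ?_)
    intro h
    apply hM
    rw [← map_comap_eq_self_of_surjective hπ M, Subgroup.map_eq_bot_iff, hker]
    exact (congrArg Subtype.val h).ge
  · have hBM' : B ≤ M.comap π := map_le_iff_le_comap.1 hBM
    have hcomm : ⁅M.comap π, M.comap π⁆ ≤ K := by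
      refine le_of_le_of_eq ?_ hker
      rw [← Subgroup.map_eq_bot_iff, map_commutator, map_comap_eq_self_of_surjective hπ,
        commutator_eq_bot_iff_le_centralizer, le_centralizer_iff_isMulCommutative]
      exact hMc
    by_contra hne
    refine hBmax ⟨M.comap π, hAB.trans hBM'⟩
      ⟨inferInstance, K, hKn, hcomm, hKB.trans hBM', hKv⟩ (lt_of_le_of_ne hBM' ?_)
    intro h
    apply hne
    rw [← map_comap_eq_self_of_surjective hπ M]
    exact congrArg (Subgroup.map π) (congrArg Subtype.val h).symm

universe u

theorem virtuallyNilpotent_of_lowerCentralSeries_succ_le (c : ℕ) {Q : Type u} [Group Q]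
    [Group.FG Q] (hQ : MetabelianQuotientsVirtuallyNilpotent Q) {A : Subgroup Q} [A.Normal]
    [IsMulCommutative A] (hA : (⊤ : Subgroup Q).lowerCentralSeries (c + 1) ≤ A) :
    VirtuallyNilpotent Q := by
  induction c generalizing Q with
  | zero =>
    refine hQ.virtuallyNilpotent_of_surjective (H := ⊤) inferInstance
      (f := (topEquiv (G := Q)).toMonoidHom) topEquiv.surjective ?_
    have h : derivedSeries Q 1 ≤ A := hA
    rw [derivedSeries_succ, eq_bot_iff]
    refine (commutator_mono h h).trans (commutator_eq_bot_iff_le_centralizer.2 ?_).le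
    exact le_centralizer_iff_isMulCommutative.2 inferInstance
  | succ c ih =>
    by_contra hv
    obtain ⟨K, hK, B, hBn, hBc, hB, hKv, hmin, hmax⟩ := exists_minimal_quotient hA hv
    have hQK := hQ.of_surjective (QuotientGroup.mk'_surjective K)
    refine hKv (virtuallyNilpotent_of_minimal hB (fun C hC hCB => ?_) hmin hmax)
    refine ih (hQK.of_finiteIndex C) (A := B.subgroupOf C) ?_
    rw [subgroupOf, ← map_le_iff_le_comap, top_subtype_lowerCentralSeries]
    exact hCB

theorem virtuallyNilpotent_of_derivedSeries_eq_bot (d : ℕ) {Q : Type u} [Group Q]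
    [Group.FG Q] (hQ : MetabelianQuotientsVirtuallyNilpotent Q) (hd : derivedSeries Q d = ⊥) :
    VirtuallyNilpotent Q := by
  induction d generalizing Q with
  | zero =>
    rw [virtuallyNilpotent_iff_mod_bot]
    exact ⟨⊤, inferInstance, 0, hd.le⟩
  | succ d ih =>
    let A := derivedSeries Q d
    have hAc : IsMulCommutative A := by
      rw [← le_centralizer_iff_isMulCommutative, ← commutator_eq_bot_iff_le_centralizer]
      exact hd
    have hsurj := QuotientGroup.mk'_surjective A
    have hv : VirtuallyNilpotent (Q ⧸ A) := ih (hQ.of_surjective hsurj) <| by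
      rw [← map_derivedSeries_eq hsurj, Subgroup.map_eq_bot_iff, QuotientGroup.ker_mk']
    rw [virtuallyNilpotent_iff_ker hsurj, QuotientGroup.ker_mk'] at hv
    obtain ⟨L, hL, n, hn⟩ := hv
    refine (virtuallyNilpotent_of_lowerCentralSeries_succ_le n (hQ.of_finiteIndex L)
      (A := A.subgroupOf L) ?_).of_finiteIndex
    rw [subgroupOf, ← map_le_iff_le_comap, top_subtype_lowerCentralSeries]
    exact (Subgroup.lowerCentralSeries_antitone L n.le_succ).trans hn

end Reduction

/-- Let `G` be a finitely generated group such that every metabelian quotient of every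
finite-index subgroup of `G` is virtually nilpotent.  Then every solvable quotient of every
finite-index subgroup of `G` is virtually nilpotent. -/
theorem solvable_quotients_virtNilpotent_of_metabelian_quotients_virtNilpotent
    (G : Type*) [Group G] (hfg : Group.FG G)
    (hmeta : ∀ H : Subgroup G, H.FiniteIndex →
      ∀ (N : Subgroup ↥H) [N.Normal],
        derivedSeries (↥H ⧸ N) 2 = ⊥ → VirtuallyNilpotent (↥H ⧸ N)) :
    ∀ H : Subgroup G, H.FiniteIndex →
      ∀ (N : Subgroup ↥H) [N.Normal],
        IsSolvable (↥H ⧸ N) → VirtuallyNilpotent (↥H ⧸ N) := by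
  intro H hH N _ hsol
  have hN := QuotientGroup.mk'_surjective N
  have : Group.FG H := H.fg_of_index_ne_zero
  have : Group.FG (H ⧸ N) := Group.fg_of_surjective hN
  obtain ⟨d, hd⟩ := (Group.isSolvable_def (H ⧸ N)).1 hsol
  have hG : MetabelianQuotientsVirtuallyNilpotent G := hmeta
  exact virtuallyNilpotent_of_derivedSeries_eq_bot d ((hG.of_finiteIndex H).of_surjective hN) hd
end

section
/- Let G be a group whose abelianization is finitely generated, and let χ : G → ℂˣ be a nontrivial character. Then restriction of 1-cocycles to the derived subgroup DG induces a ℂ-linear isomorphism from H¹(G, ℂ_χ) onto the space of group homomorphisms u : DG → (ℂ,+) satisfying u(g x g⁻¹) = χ(g)·u(x) for all g ∈ G and x ∈ DG, i.e. onto Hom_G((DG)_ab, ℂ_χ). (Isomorphism from the Hochschild–Serre spectral sequence stated in §3.1, following [Be 92, 4.2].) -/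
/-- A `1`-cocycle of a group `G` with values in the one-dimensional representation `ℂ_χ`
attached to a character `χ : G → ℂˣ`. -/
def IsCocycle {G : Type*} [Group G] (χ : G →* ℂˣ) (c : G → ℂ) : Prop :=
  ∀ g h : G, c (g * h) = c g + (χ g : ℂ) * c h

/-- A `1`-coboundary of a group `G` with values in `ℂ_χ`. -/
def IsCoboundary {G : Type*} [Group G] (χ : G →* ℂˣ) (c : G → ℂ) : Prop :=
  ∃ z : ℂ, ∀ g : G, c g = (χ g : ℂ) * z - z

theorem MonoidHom.coe_units_eq_one_of_mem_commutator {G : Type*} [Group G] (χ : G →* ℂˣ) {x : G}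
    (hx : x ∈ commutator G) : (χ x : ℂ) = 1 := by
  rw [MonoidHom.mem_ker.mp (Abelianization.commutator_subset_ker χ hx), Units.val_one]

theorem IsCocycle.map_one {G : Type*} [Group G] {χ : G →* ℂˣ} {c : G → ℂ} (hc : IsCocycle χ c) :
    c 1 = 0 := by
  simpa using hc 1 1

theorem IsCocycle.map_mul_of_mem_commutator {G : Type*} [Group G] {χ : G →* ℂˣ} {c : G → ℂ}
    (hc : IsCocycle χ c) {x : G} (hx : x ∈ commutator G) (y : G) : c (x * y) = c x + c y := by
  rw [hc, χ.coe_units_eq_one_of_mem_commutator hx, one_mul]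

theorem IsCocycle.map_conj_of_mem_commutator {G : Type*} [Group G] {χ : G →* ℂˣ} {c : G → ℂ}
    (hc : IsCocycle χ c) (g : G) {x : G} (hx : x ∈ commutator G) :
    c (g * x * g⁻¹) = (χ g : ℂ) * c x := by
  have hg : c g + (χ g : ℂ) * c g⁻¹ = 0 := by rw [← hc, mul_inv_cancel, hc.map_one]
  rw [mul_assoc, hc, hc.map_mul_of_mem_commutator hx]
  linear_combination hg

open scoped commutatorElement in
theorem IsCocycle.isCoboundary_of_vanishing_on_commutator {G : Type*} [Group G] {χ : G →* ℂˣ}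
    {c : G → ℂ} (hc : IsCocycle χ c) (h0 : ∀ x ∈ commutator G, c x = 0) {t : G}
    (ht : (χ t : ℂ) - 1 ≠ 0) : IsCoboundary χ c := by
  refine ⟨c t / ((χ t : ℂ) - 1), fun g => ?_⟩
  have hmem : ⁅t, g⁆ ∈ commutator G :=
    Subgroup.commutator_mem_commutator (Subgroup.mem_top t) (Subgroup.mem_top g)
  have hswap : c (t * g) = c (g * t) := by
    rw [show t * g = ⁅t, g⁆ * (g * t) by rw [commutatorElement_def]; group,
      hc.map_mul_of_mem_commutator hmem, h0 _ hmem, zero_add]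
  rw [hc, hc] at hswap
  field_simp
  linear_combination hswap

open scoped commutatorElement in
/-- The extension is the unique one vanishing at `t`, namely `g ↦ u ⁅t, g⁆ / (χ t - 1)`. -/
theorem exists_isCocycle_extending_equivariant_hom {G : Type*} [Group G] {χ : G →* ℂˣ} {t : G}
    (ht : (χ t : ℂ) - 1 ≠ 0) (u : ↥(commutator G) → ℂ)
    (hadd : ∀ x y : ↥(commutator G), u (x * y) = u x + u y)
    (hconj : ∀ (g : G) (x y : ↥(commutator G)),
      (y : G) = g * (x : G) * g⁻¹ → u y = (χ g : ℂ) * u x) :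
    ∃ c : G → ℂ, IsCocycle χ c ∧ ∀ x : ↥(commutator G), c (x : G) = u x := by
  let k (g : G) : ↥(commutator G) :=
    ⟨⁅t, g⁆, Subgroup.commutator_mem_commutator (Subgroup.mem_top t) (Subgroup.mem_top g)⟩
  have hk (g : G) : (k g : G) = t * g * t⁻¹ * g⁻¹ := rfl
  refine ⟨fun g => u (k g) / ((χ t : ℂ) - 1), fun g h => ?_, fun x => ?_⟩
  · let y : ↥(commutator G) := (k g)⁻¹ * k (g * h)
    have hy : u y = (χ g : ℂ) * u (k h) := by
      refine hconj g (k h) y ?_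
      simp only [y, Subgroup.coe_mul, Subgroup.coe_inv, hk]
      group
    have hgh : u (k (g * h)) = u (k g) + u y := by rw [← hadd, mul_inv_cancel_left]
    simp only [hgh, hy]
    ring
  · have hx : u (k x * x) = (χ t : ℂ) * u x := by
      refine hconj t x _ ?_
      simp only [Subgroup.coe_mul, hk]
      group
    rw [hadd] at hx
    rw [div_eq_iff ht]
    linear_combination hx

/-- Let `G` have finitely generated abelianization and let `χ : G → ℂˣ` be a nontrivial
character.  Restriction of `1`-cocycles to the derived subgroup `DG` induces a linear
isomorphism `H¹(G, ℂ_χ) ≅ Hom_G((DG)_ab, ℂ_χ)`: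
(i) the restriction of a cocycle to `DG` is an additive, `χ`-equivariant homomorphism;
(ii) a cocycle vanishing on `DG` is a coboundary (injectivity, coboundaries restricting to `0`);
(iii) every `χ`-equivariant additive homomorphism `DG → ℂ` is the restriction of a cocycle
(surjectivity). -/
theorem H1_iso_equivariant_homs_of_derived_subgroup
    {G : Type*} [Group G] (hfg : Group.FG (Abelianization G))
    (χ : G →* ℂˣ) (hχ : χ ≠ 1) :
    (∀ c : G → ℂ, IsCocycle χ c →
        (∀ x y : G, x ∈ commutator G → y ∈ commutator G → c (x * y) = c x + c y) ∧
        (∀ (g x : G), x ∈ commutator G → c (g * x * g⁻¹) = (χ g : ℂ) * c x)) ∧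
      (∀ c : G → ℂ, IsCocycle χ c → (∀ x ∈ commutator G, c x = 0) → IsCoboundary χ c) ∧
      (∀ u : ↥(commutator G) → ℂ,
        (∀ x y : ↥(commutator G), u (x * y) = u x + u y) →
        (∀ (g : G) (x y : ↥(commutator G)),
          (y : G) = g * (x : G) * g⁻¹ → u y = (χ g : ℂ) * u x) →
        ∃ c : G → ℂ, IsCocycle χ c ∧ ∀ x : ↥(commutator G), c (x : G) = u x) := by
  obtain ⟨t, ht⟩ : ∃ t : G, (χ t : ℂ) - 1 ≠ 0 := by
    obtain ⟨t, ht⟩ := DFunLike.ne_iff.mp hχ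
    exact ⟨t, sub_ne_zero.mpr fun h => ht (Units.ext h)⟩
  exact ⟨fun c hc => ⟨fun x y hx _ => hc.map_mul_of_mem_commutator hx y,
      fun g x hx => hc.map_conj_of_mem_commutator g hx⟩,
    fun c hc h0 => hc.isCoboundary_of_vanishing_on_commutator h0 ht,
    fun u hadd hconj => exists_isCocycle_extending_equivariant_hom ht u hadd hconj⟩
end

section
/- Let f : G → H be a surjective group homomorphism, with G finitely generated and with kernel generated by a set of elements of finite order. Then the precomposition map f* : Hom(H, ℂˣ) → Hom(G, ℂˣ) between character groups is an injective group homomorphism whose cokernel is finite: the quotient of the abelian group Hom(G, ℂˣ) by the image of f* is a finite group. (Claim stated in §3.2.) -/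
/-- The torsion subgroup of a finitely generated commutative group is finite. -/
theorem CommGroup.finite_torsion_of_fg (A : Type*) [CommGroup A] [Group.FG A] :
    Finite (CommGroup.torsion A) := by
  have : Module.Finite ℤ (Additive A) := Module.Finite.iff_addGroup_fg.mpr inferInstance
  have : Finite (Submodule.torsion ℤ (Additive A)) :=
    Module.finite_of_fg_torsion _ Submodule.torsion_isTorsion
  refine .of_injective (β := Submodule.torsion ℤ (Additive A))
    (fun x ↦ ⟨Additive.ofMul x.1, ?_⟩) fun x y h ↦ Subtype.ext (congrArg (·.1.toMul) h)
  obtain ⟨n, hn, hx⟩ := isOfFinOrder_iff_zpow_eq_one.mp x.2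
  exact ⟨⟨n, mem_nonZeroDivisors_of_ne_zero hn⟩, congrArg Additive.ofMul hx⟩

/-- A character is pulled back along a surjective homomorphism as soon as it is trivial on the
kernel. -/
theorem MonoidHom.mem_range_compHom'_of_ker_le {G H M : Type*} [Group G] [Group H] [CommGroup M]
    {f : G →* H} (hf : Function.Surjective f) {χ : G →* M} (h : f.ker ≤ χ.ker) :
    χ ∈ (MonoidHom.compHom' (P := M) f).range :=
  ⟨f.liftOfSurjective hf ⟨χ, h⟩,
    f.liftOfRightInverse_comp _ (Function.rightInverse_surjInv hf) ⟨χ, h⟩⟩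

/-- The restriction of characters of `G` to the torsion subgroup of its abelianization. -/
def Abelianization.restrictTorsion (G M : Type*) [Group G] [CommGroup M] :
    (G →* M) →* (CommGroup.torsion (Abelianization G) →* M) where
  toFun χ := (Abelianization.lift χ).comp (CommGroup.torsion (Abelianization G)).subtype
  map_one' := by
    ext ⟨x, _⟩
    obtain ⟨g, rfl⟩ := QuotientGroup.mk_surjective x
    rfl
  map_mul' χ ψ := by
    ext ⟨x, _⟩
    obtain ⟨g, rfl⟩ := QuotientGroup.mk_surjective x
    rfl

theorem Abelianization.apply_eq_one_of_mem_ker_restrictTorsion {G M : Type*} [Group G]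
    [CommGroup M] {χ : G →* M} (hχ : χ ∈ (Abelianization.restrictTorsion G M).ker) {g : G}
    (hg : IsOfFinOrder g) : χ g = 1 :=
  DFunLike.congr_fun (MonoidHom.mem_ker.mp hχ)
    (⟨Abelianization.of g, Abelianization.of.isOfFinOrder hg⟩ :
      CommGroup.torsion (Abelianization G))


/-- Let `f : G → H` be a surjective homomorphism with `G` finitely generated and with kernel
generated by a set of elements of finite order.  Then the precomposition map
`f* : Hom(H, ℂˣ) → Hom(G, ℂˣ)` between character groups is an injective group homomorphism with
finite cokernel. -/
theorem character_group_precomposition_injective_finite_cokernel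
    {G H : Type*} [Group G] [Group H]
    (f : G →* H) (hsurj : Function.Surjective f) (hfg : Group.FG G)
    (S : Set G) (hker : f.ker = Subgroup.closure S) (htors : ∀ s ∈ S, IsOfFinOrder s) :
    Function.Injective (MonoidHom.compHom' (P := ℂˣ) f) ∧
      Finite ((G →* ℂˣ) ⧸ (MonoidHom.compHom' (P := ℂˣ) f).range) := by
  refine ⟨fun χ ψ h ↦ (MonoidHom.cancel_right hsurj).mp h, ?_⟩
  have : Group.FG (Abelianization G) := QuotientGroup.fg _
  have : Finite (CommGroup.torsion (Abelianization G)) := CommGroup.finite_torsion_of_fg _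
  have hle : (Abelianization.restrictTorsion G ℂˣ).ker ≤
      (MonoidHom.compHom' (P := ℂˣ) f).range := fun χ hχ ↦
    MonoidHom.mem_range_compHom'_of_ker_le hsurj <| hker ▸ (Subgroup.closure_le _).mpr fun s hs ↦
      Abelianization.apply_eq_one_of_mem_ker_restrictTorsion hχ (htors s hs)
  have := Subgroup.finiteIndex_of_le hle
  exact Subgroup.finite_quotient_of_finiteIndex
end
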